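/- Let K be a simplicial complex on the vertex set [m], and let L_K = { y ∈ ℝ^m : there exists a face I ∈ K with y_k ∈ ℤ for all k ∉ I }. Then L_K is aspherical (i.e., it is path-connected and for every point y ∈ L_K and every n ≥ 2 the homotopy group π_n(L_K, y) is trivial) if and only if K is a flag complex. -/

import Mathlib

/-- The polyhedral product `L_K = (ℝ, ℤ)^K ⊆ ℝ^m`: the subspace of `ℝ^m` consisting of points
`y` for which there is a face `I ∈ K` with `y_k ∈ ℤ` for all `k ∉ I`. -/
abbrev realPolyhedralProduct (m : ℕ) (K : Finset (Finset (Fin m))) : Type :=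
  { y : Fin m → ℝ // ∃ I ∈ K, ∀ k, k ∉ I → ∃ n : ℤ, y k = n }

/-- The `j`-th vertex of the Freudenthal simplex based at `a` in which coordinate `c` is
incremented at step `σ c`. -/
def freudenthalVertex {N : ℕ} (a : Fin N → ℕ) (σ : Equiv.Perm (Fin N)) (j : ℕ) : Fin N → ℕ :=
  fun c => a c + if (σ c : ℕ) < j then 1 else 0

theorem freudenthalVertex_swap {N : ℕ} (a : Fin (N + 1) → ℕ) (σ : Equiv.Perm (Fin (N + 1)))
    (j : Fin N) (i : ℕ) (hi : i ≠ j + 1) :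
    freudenthalVertex a (Equiv.swap j.castSucc j.succ * σ) i = freudenthalVertex a σ i := by
  funext c
  simp only [freudenthalVertex, Equiv.Perm.coe_mul, Function.comp_apply, Nat.add_left_cancel_iff]
  have : ((Equiv.swap j.castSucc j.succ (σ c) : Fin (N + 1)) : ℕ) < i ↔ (σ c : ℕ) < i := by
    rw [Equiv.swap_apply_def]
    split_ifs with h1 h2
    · rw [h1]; simp; omega
    · rw [h2]; simp; omega
    · rfl
  simp only [this]

theorem freudenthalVertex_rotate {N : ℕ} (a : Fin (N + 1) → ℕ) (σ : Equiv.Perm (Fin (N + 1)))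
    (i : ℕ) (hi : i ≤ N) :
    freudenthalVertex a (finRotate (N + 1) * σ) (i + 1) =
      freudenthalVertex (fun c => a c + if c = σ.symm (Fin.last N) then 1 else 0) σ i := by
  funext c
  simp only [freudenthalVertex, Equiv.Perm.coe_mul, Function.comp_apply]
  by_cases h : c = σ.symm (Fin.last N)
  · subst h
    simp
    omega
  · have h' : σ c ≠ Fin.last N := fun h2 => h (by rw [← h2]; simp)
    have h3 : (σ c : ℕ) < N := by
      have := (σ c).2
      have h4 : (σ c : ℕ) ≠ N := fun h5 => h' (Fin.ext (by simpa using h5))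
      omega
    have : ((finRotate (N + 1) (σ c) : Fin (N + 1)) : ℕ) = σ c + 1 := by
      rw [coe_finRotate_of_ne_last h']
    simp only [this]
    simp [h]

/-- The order embedding `ℕ → ℕ` whose range omits `j`. -/
def skipNat (j i : ℕ) : ℕ := if i < j then i else i + 1

/-- The cocycle identity for a cup product of coboundaries, in characteristic two. -/
theorem prod_sub_shift_eq {R V : Type*} [CommRing R] [CharP R 2] {M : ℕ} (A : Fin M → V → R)
    (x : ℕ → V) :
    ∏ i : Fin M, (A i (x (i + 2)) - A i (x (i + 1))) =
      ∏ i : Fin M, (A i (x (i + 1)) - A i (x i)) +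
        ∑ j : Fin M, ∏ i : Fin M,
          (A i (x (skipNat (j + 1) (i + 1))) - A i (x (skipNat (j + 1) i))) := by
  set P : ℕ → R := fun j => ∏ i : Fin M, (if (i : ℕ) < j then A i (x (i + 1)) - A i (x i)
    else A i (x (i + 2)) - A i (x (i + 1))) with hP
  have h0 : P 0 = ∏ i : Fin M, (A i (x (i + 2)) - A i (x (i + 1))) := by simp [hP]
  have hM : P M = ∏ i : Fin M, (A i (x (i + 1)) - A i (x i)) := by simp [hP]
  have key : ∀ j : Fin M, ∏ i : Fin M,
      (A i (x (skipNat (j + 1) (i + 1))) - A i (x (skipNat (j + 1) i))) = P (j + 1) - P j := by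
    intro j
    rw [CharTwo.sub_eq_add]
    simp only [hP]
    rw [← Finset.mul_prod_erase _ _ (Finset.mem_univ j),
      ← Finset.mul_prod_erase (a := j) _ (fun i : Fin M => if (i : ℕ) < (j : ℕ) + 1 then _ else _)
        (Finset.mem_univ j),
      ← Finset.mul_prod_erase (a := j) _ (fun i : Fin M => if (i : ℕ) < (j : ℕ) then _ else _)
        (Finset.mem_univ j)]
    have e1 : ∀ i ∈ Finset.univ.erase j,
        (A i (x (skipNat (j + 1) (i + 1))) - A i (x (skipNat (j + 1) i))) =
        (if (i : ℕ) < j then A i (x (i + 1)) - A i (x i)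
          else A i (x (i + 2)) - A i (x (i + 1))) := by
      intro i hi
      have hij : (i : ℕ) ≠ j := fun h => (Finset.mem_erase.1 hi).1 (Fin.ext h)
      simp only [skipNat]
      split_ifs <;> first | rfl | omega
    have e2 : ∀ i ∈ Finset.univ.erase j,
        (if (i : ℕ) < (j : ℕ) + 1 then A i (x (i + 1)) - A i (x i)
          else A i (x (i + 2)) - A i (x (i + 1))) =
        (if (i : ℕ) < j then A i (x (i + 1)) - A i (x i)
          else A i (x (i + 2)) - A i (x (i + 1))) := by
      intro i hi
      have hij : (i : ℕ) ≠ j := fun h => (Finset.mem_erase.1 hi).1 (Fin.ext h)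
      split_ifs <;> first | rfl | omega
    rw [Finset.prod_congr rfl e1, Finset.prod_congr rfl e2, ← add_mul]
    congr 1
    simp [skipNat]
  rw [Finset.sum_congr rfl fun j _ => key j, Fin.sum_univ_eq_sum_range (fun j => P (j + 1) - P j),
    Finset.sum_range_sub, ← h0, ← hM,
    CharTwo.sub_eq_add, ← add_assoc, CharTwo.add_self_eq_zero, zero_add]

/-- The mod two number of Freudenthal simplices of the grid on which the coboundaries of all
the labels `F i` are non-zero. -/
def cupSum (k N : ℕ) (F : Fin N → (Fin N → ℕ) → ZMod 2) : ZMod 2 :=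
  ∑ σ : Equiv.Perm (Fin N), ∑ a : Fin N → Fin k, ∏ i : Fin N,
    (F i (freudenthalVertex (fun c => a c) σ (i + 1)) - F i (freudenthalVertex (fun c => a c) σ i))

theorem sum_sub_shift {R : Type*} [CommRing R] {N k : ℕ} (G : (Fin (N + 1) → ℕ) → R)
    (p : Fin (N + 1)) :
    ∑ a : Fin (N + 1) → Fin k, (G (fun c => a c + if c = p then 1 else 0) - G fun c => a c) =
      ∑ b : Fin N → Fin k, (G (p.insertNth k fun c => (b c : ℕ)) -
        G (p.insertNth 0 fun c => (b c : ℕ))) := by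
  rw [← (Fin.insertNthEquiv (fun _ => Fin k) p).sum_comp, Fintype.sum_prod_type_right]
  refine Finset.sum_congr rfl fun b _ => ?_
  have e1 : ∀ t : Fin k, (fun c => (((Fin.insertNthEquiv (fun _ => Fin k) p) (t, b) c : Fin k) : ℕ))
      = (p.insertNth (t : ℕ) fun c => (b c : ℕ)) := by
    intro t
    funext c
    refine Fin.succAboveCases p ?_ (fun i => ?_) c <;> simp
  have e2 : ∀ t : Fin k, (fun c => (((Fin.insertNthEquiv (fun _ => Fin k) p) (t, b) c : Fin k) : ℕ)
      + if c = p then 1 else 0) = (p.insertNth (t + 1 : ℕ) fun c => (b c : ℕ)) := by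
    intro t
    funext c
    refine Fin.succAboveCases p ?_ (fun i => ?_) c <;> simp
  simp only [e1, e2]
  rw [Fin.sum_univ_eq_sum_range (fun t => G (p.insertNth (t + 1 : ℕ) fun c => (b c : ℕ)) -
    G (p.insertNth (t : ℕ) fun c => (b c : ℕ))),
    Finset.sum_range_sub (fun t => G (p.insertNth (t : ℕ) fun c => (b c : ℕ)))]

/-- The contribution of the facet opposite to the last vertex. -/
def facetTerm {N : ℕ} (F : Fin (N + 1) → (Fin (N + 1) → ℕ) → ZMod 2)
    (σ : Equiv.Perm (Fin (N + 1))) (a : Fin (N + 1) → ℕ) : ZMod 2 :=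
  F 0 (freudenthalVertex a σ 0) * ∏ i : Fin N,
    (F i.succ (freudenthalVertex a σ (i + 1)) - F i.succ (freudenthalVertex a σ i))

theorem cupSum_succ_eq_boundary (k N : ℕ) (F : Fin (N + 1) → (Fin (N + 1) → ℕ) → ZMod 2) :
    cupSum k (N + 1) F = ∑ σ : Equiv.Perm (Fin (N + 1)), ∑ b : Fin N → Fin k,
      (facetTerm F σ ((σ.symm (Fin.last N)).insertNth k fun c => (b c : ℕ)) -
        facetTerm F σ ((σ.symm (Fin.last N)).insertNth 0 fun c => (b c : ℕ))) := by
  have hsplit : cupSum k (N + 1) F =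
      ∑ σ : Equiv.Perm (Fin (N + 1)), ∑ a : Fin (N + 1) → Fin k,
        F 0 (freudenthalVertex (fun c => a c) σ 1) * (∏ i : Fin N,
          (F i.succ (freudenthalVertex (fun c => a c) σ (i + 2)) -
            F i.succ (freudenthalVertex (fun c => a c) σ (i + 1)))) -
      ∑ σ : Equiv.Perm (Fin (N + 1)), ∑ a : Fin (N + 1) → Fin k,
        facetTerm F σ (fun c => a c) -
      ∑ a : Fin (N + 1) → Fin k, ∑ j : Fin N, ∑ σ : Equiv.Perm (Fin (N + 1)),
        F 0 (freudenthalVertex (fun c => a c) σ 0) * ∏ i : Fin N,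
          (F i.succ (freudenthalVertex (fun c => a c) σ (skipNat (j + 1) (i + 1))) -
            F i.succ (freudenthalVertex (fun c => a c) σ (skipNat (j + 1) i))) := by
    have hcomm : ∀ H : (Fin (N + 1) → Fin k) → Fin N → Equiv.Perm (Fin (N + 1)) → ZMod 2,
        ∑ a, ∑ j, ∑ σ, H a j σ = ∑ σ, ∑ a, ∑ j, H a j σ := by
      intro H
      rw [Finset.sum_comm (s := Finset.univ (α := Equiv.Perm (Fin (N + 1))))]
      exact Finset.sum_congr rfl fun a _ => Finset.sum_comm
    rw [hcomm, ← Finset.sum_sub_distrib, ← Finset.sum_sub_distrib, cupSum]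
    refine Finset.sum_congr rfl fun σ _ => ?_
    rw [← Finset.sum_sub_distrib, ← Finset.sum_sub_distrib]
    refine Finset.sum_congr rfl fun a _ => ?_
    have h := prod_sub_shift_eq (fun i : Fin N => F i.succ)
      (freudenthalVertex (fun c => (a c : ℕ)) σ)
    rw [Fin.prod_univ_succ, facetTerm, ← Finset.mul_sum]
    simp only [Fin.val_zero, zero_add, Fin.val_succ, add_assoc, one_add_one_eq_two] at h ⊢
    rw [sub_mul]
    conv_lhs => rw [h]
    rw [h]
    ring
  have hzero : ∀ (a : Fin (N + 1) → Fin k) (j : Fin N), ∑ σ : Equiv.Perm (Fin (N + 1)),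
      F 0 (freudenthalVertex (fun c => a c) σ 0) * ∏ i : Fin N,
        (F i.succ (freudenthalVertex (fun c => a c) σ (skipNat (j + 1) (i + 1))) -
          F i.succ (freudenthalVertex (fun c => a c) σ (skipNat (j + 1) i))) = 0 := by
    intro a j
    refine Finset.sum_involution (fun σ _ => Equiv.swap j.castSucc j.succ * σ) ?_ ?_ ?_ ?_
    · intro σ _
      have hs : ∀ i, freudenthalVertex (fun c => (a c : ℕ)) (Equiv.swap j.castSucc j.succ * σ)
          (skipNat (j + 1) i) = freudenthalVertex (fun c => (a c : ℕ)) σ (skipNat (j + 1) i) := by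
        intro i
        refine freudenthalVertex_swap _ _ _ _ ?_
        unfold skipNat
        split_ifs <;> omega
      rw [freudenthalVertex_swap _ _ _ 0 (by omega)]
      simp only [hs]
      exact CharTwo.add_self_eq_zero _
    · intro σ _ _ h
      have h1 : Equiv.swap j.castSucc j.succ = 1 := by simpa using h
      rw [Equiv.Perm.one_def, Equiv.swap_eq_refl_iff] at h1
      exact absurd (congrArg Fin.val h1) (by simp)
    · intro σ _
      exact Finset.mem_univ _
    · intro σ _
      rw [← mul_assoc, Equiv.swap_mul_self, one_mul]
  rw [hsplit]
  simp only [hzero, Finset.sum_const_zero, sub_zero]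
  rw [← Equiv.sum_comp (Equiv.mulLeft (finRotate (N + 1))), ← Finset.sum_sub_distrib]
  refine Finset.sum_congr rfl fun σ _ => ?_
  rw [← Finset.sum_sub_distrib, ← sum_sub_shift]
  refine Finset.sum_congr rfl fun a _ => ?_
  congr 1
  simp only [Equiv.coe_mulLeft, facetTerm]
  have h := freudenthalVertex_rotate (fun c => (a c : ℕ)) σ
  rw [← h 0 (by omega)]
  congr 1
  refine Finset.prod_congr rfl fun i _ => ?_
  rw [← h _ (by omega), ← h _ (by omega)]

theorem cupSum_eq_one (k N : ℕ) (F : Fin N → (Fin N → ℕ) → ZMod 2)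
    (h0 : ∀ i x, x i = 0 → F i x = 0) (h1 : ∀ i x, x i = k → F i x = 1) : cupSum k N F = 1 := by
  induction N with
  | zero => simp [cupSum]
  | succ N ih =>
    rw [cupSum_succ_eq_boundary]
    have hvtx : ∀ (σ : Equiv.Perm (Fin (N + 1))) (t : ℕ) (b : Fin N → ℕ) (j : ℕ), j ≤ N →
        freudenthalVertex ((σ.symm (Fin.last N)).insertNth t b) σ j (σ.symm (Fin.last N)) = t := by
      intro σ t b j hj
      simp [freudenthalVertex]
      omega
    have hconst : ∀ (σ : Equiv.Perm (Fin (N + 1))) (t : ℕ) (e : ZMod 2) (b : Fin N → ℕ),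
        (∀ i x, x i = t → F i x = e) → σ.symm (Fin.last N) ≠ 0 →
        facetTerm F σ ((σ.symm (Fin.last N)).insertNth t b) = 0 := by
      intro σ t e b he hp
      obtain ⟨i, hi⟩ := Fin.exists_succ_eq.2 hp
      rw [facetTerm, Finset.prod_eq_zero (Finset.mem_univ i), mul_zero]
      rw [hi, he _ _ (hvtx σ t b _ (by omega)), he _ _ (hvtx σ t b _ (by omega)), sub_self]
    let Φ : Equiv.Perm (Option (Fin N)) ≃ Equiv.Perm (Fin (N + 1)) :=
      (Equiv.equivCongr (finSuccEquiv N) (finSuccEquivLast)).symm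
    rw [← (Equiv.Perm.decomposeOption.symm.trans Φ).sum_comp, Fintype.sum_prod_type,
      Fintype.sum_option]
    have hnone : ∀ τ : Equiv.Perm (Fin N),
        ((Equiv.Perm.decomposeOption.symm.trans Φ) (none, τ)).symm (Fin.last N) = 0 := by
      intro τ
      rw [Equiv.symm_apply_eq]
      simp [Φ, Equiv.equivCongr]
    have hsome : ∀ (i : Fin N) (τ : Equiv.Perm (Fin N)),
        ((Equiv.Perm.decomposeOption.symm.trans Φ) (some i, τ)).symm (Fin.last N) ≠ 0 := by
      intro i τ
      rw [Ne, Equiv.symm_apply_eq]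
      simp [Φ, Equiv.equivCongr]
      exact (Fin.castSucc_lt_last i).ne'
    have hz : ∑ i : Fin N, ∑ τ : Equiv.Perm (Fin N), ∑ b : Fin N → Fin k,
        (facetTerm F ((Equiv.Perm.decomposeOption.symm.trans Φ) (some i, τ))
          ((((Equiv.Perm.decomposeOption.symm.trans Φ) (some i, τ)).symm (Fin.last N)).insertNth k
            fun c => (b c : ℕ)) -
        facetTerm F ((Equiv.Perm.decomposeOption.symm.trans Φ) (some i, τ))
          ((((Equiv.Perm.decomposeOption.symm.trans Φ) (some i, τ)).symm (Fin.last N)).insertNth 0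
            fun c => (b c : ℕ))) = 0 := by
      refine Finset.sum_eq_zero fun i _ => Finset.sum_eq_zero fun τ _ =>
        Finset.sum_eq_zero fun b _ => ?_
      rw [hconst _ _ _ _ h1 (hsome i τ), hconst _ _ _ _ h0 (hsome i τ), sub_self]
    rw [hz, add_zero, ← ih (fun i x => F i.succ (Fin.cons k x))
      (fun i x hx => h0 _ _ (by simpa using hx)) (fun i x hx => h1 _ _ (by simpa using hx)), cupSum]
    refine Finset.sum_congr rfl fun τ _ => Finset.sum_congr rfl fun b _ => ?_
    have hcons : ∀ j ≤ N, freudenthalVertex (Fin.cons k fun c => (b c : ℕ))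
        ((Equiv.Perm.decomposeOption.symm.trans Φ) (none, τ)) j =
        Fin.cons k (freudenthalVertex (fun c => (b c : ℕ)) τ j) := by
      intro j hj
      funext c
      refine Fin.cases ?_ (fun c => ?_) c
      · have := (Equiv.symm_apply_eq _).1 (hnone τ)
        simp only [freudenthalVertex, ← this]
        simp
        omega
      · simp [freudenthalVertex, Φ, Equiv.equivCongr]
    rw [hnone]
    simp only [Fin.insertNth_zero']
    simp only [facetTerm]
    rw [h0 0 (freudenthalVertex (Fin.cons 0 _) _ 0) (by simp [freudenthalVertex]), zero_mul, sub_zero,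
      hcons 0 (by omega), h1 0 _ (by simp), one_mul]
    refine Finset.prod_congr rfl fun i _ => ?_
    rw [hcons _ (by omega), hcons _ (by omega)]

/-- A discrete Poincaré–Miranda theorem. -/
theorem exists_cell_of_boundary_labels (k N : ℕ) (F : Fin N → (Fin N → ℕ) → ZMod 2)
    (h0 : ∀ i x, x i = 0 → F i x = 0) (h1 : ∀ i x, x i = k → F i x = 1) :
    ∃ a : Fin N → Fin k, ∀ i, ∃ p q : Fin N → ℕ, F i p = 0 ∧ F i q = 1 ∧
      ∀ c, ((a c : ℕ) ≤ p c ∧ p c ≤ a c + 1) ∧ ((a c : ℕ) ≤ q c ∧ q c ≤ a c + 1) := by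
  have hone := cupSum_eq_one k N F h0 h1
  have hne : cupSum k N F ≠ 0 := by rw [hone]; exact one_ne_zero
  obtain ⟨σ, -, hσ⟩ := Finset.exists_ne_zero_of_sum_ne_zero hne
  obtain ⟨a, -, ha⟩ := Finset.exists_ne_zero_of_sum_ne_zero hσ
  refine ⟨a, fun i => ?_⟩
  have hi := Finset.prod_ne_zero_iff.1 ha i (Finset.mem_univ i)
  have hv : ∀ j c, (a c : ℕ) ≤ freudenthalVertex (fun c => (a c : ℕ)) σ j c ∧
      freudenthalVertex (fun c => (a c : ℕ)) σ j c ≤ a c + 1 := by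
    intro j c
    unfold freudenthalVertex
    split_ifs <;> simp
  have h2 : ∀ u v : ZMod 2, u - v ≠ 0 → (u = 0 ∧ v = 1) ∨ (u = 1 ∧ v = 0) := by decide
  rcases h2 _ _ hi with h | h
  · exact ⟨_, _, h.1, h.2, fun c => ⟨hv _ c, hv _ c⟩⟩
  · exact ⟨_, _, h.2, h.1, fun c => ⟨hv _ c, hv _ c⟩⟩

/-- The Poincaré–Miranda theorem on the cube `[-2, 2]^N`. -/
theorem exists_zero_of_boundary_sign {N : ℕ} (f : (Fin N → ℝ) → Fin N → ℝ) (hf : Continuous f)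
    (h0 : ∀ i x, (∀ c, |x c| ≤ 2) → x i = -2 → f x i ≤ 0)
    (h1 : ∀ i x, (∀ c, |x c| ≤ 2) → x i = 2 → 0 < f x i) :
    ∃ x, (∀ c, |x c| ≤ 2) ∧ f x = 0 := by
  classical
  by_contra! hcon
  have hK : IsCompact (Set.Icc (fun _ => -2 : Fin N → ℝ) (fun _ => 2)) := isCompact_Icc
  have hmem : ∀ x : Fin N → ℝ, x ∈ Set.Icc (fun _ => -2 : Fin N → ℝ) (fun _ => 2) ↔
      ∀ c, |x c| ≤ 2 := by
    intro x
    simp only [Set.mem_Icc, Pi.le_def, abs_le, ← forall_and]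
  obtain ⟨δ, hδ, hδf⟩ : ∃ δ > 0, ∀ x ∈ Set.Icc (fun _ => -2 : Fin N → ℝ) (fun _ => 2),
      δ ≤ ‖f x‖ := by
    obtain ⟨x, hx, hmin⟩ := hK.exists_isMinOn ⟨fun _ => 0, by rw [hmem]; simp⟩
      hf.norm.continuousOn
    exact ⟨‖f x‖, norm_pos_iff.2 (hcon x ((hmem x).1 hx)), fun y hy => hmin hy⟩
  have huc := Metric.uniformContinuousOn_iff.1 (hK.uniformContinuousOn_of_continuous
    hf.continuousOn) δ hδ
  obtain ⟨η, hη, hηf⟩ := huc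
  obtain ⟨k, hk⟩ := exists_nat_gt (4 / η)
  have hk0 : (0 : ℝ) < k := lt_trans (by positivity) hk
  have hkη : 4 / k < η := by
    rw [div_lt_iff₀ hη] at hk
    rw [div_lt_iff₀ hk0]
    linarith [mul_comm (k : ℝ) η]
  let s : (Fin N → ℕ) → Fin N → ℝ := fun x c => -2 + 4 * (x c / k)
  let F : Fin N → (Fin N → ℕ) → ZMod 2 := fun i x =>
    if x i = 0 then 0 else if x i = k then 1 else if 0 < f (s x) i then 1 else 0
  have hk0' : k ≠ 0 := by
    rintro rfl
    simp at hk0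
  obtain ⟨a, ha⟩ := exists_cell_of_boundary_labels k N F (fun i x hx => by simp [F, hx])
    (fun i x hx => by simp [F, hx, hk0'])
  have hs : ∀ x : Fin N → ℕ, (∀ c, x c ≤ k) → ∀ c, |s x c| ≤ 2 := by
    intro x hx c
    have h2 : (x c : ℝ) / k ≤ 1 := by
      rw [div_le_one hk0]
      exact_mod_cast hx c
    have h3 : (0 : ℝ) ≤ (x c : ℝ) / k := by positivity
    rw [abs_le]
    constructor <;> simp only [s] <;> linarith
  have hF0 : ∀ i x, (∀ c, x c ≤ k) → F i x = 0 → f (s x) i ≤ 0 := by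
    intro i x hx h
    simp only [F] at h
    split_ifs at h with h2 h3 h4
    · exact h0 i _ (hs x hx) (by simp [s, h2])
    · exact absurd h one_ne_zero
    · exact absurd h one_ne_zero
    · exact not_lt.1 h4
  have hF1 : ∀ i x, (∀ c, x c ≤ k) → F i x = 1 → 0 < f (s x) i := by
    intro i x hx h
    simp only [F] at h
    split_ifs at h with h2 h3 h4
    · exact absurd h zero_ne_one
    · exact h1 i _ (hs x hx) (by simp [s, h3, hk0.ne']; norm_num)
    · exact h4
    · exact absurd h zero_ne_one
  have hale : ∀ c, (a c : ℕ) ≤ k := fun c => (a c).2.le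
  have hdist : ∀ p : Fin N → ℕ, (∀ c, (a c : ℕ) ≤ p c ∧ p c ≤ a c + 1) →
      ∀ i, |f (s p) i - f (s fun c => a c) i| < δ := by
    intro p hp i
    have hd : dist (s p) (s fun c => a c) < η := by
      refine lt_of_le_of_lt ((dist_pi_le_iff (by positivity)).2 fun c => ?_) hkη
      rw [Real.dist_eq]
      have : s p c - s (fun c => a c) c = 4 * (((p c : ℝ) - a c) / k) := by
        simp only [s]; ring
      rw [this, abs_of_nonneg]
      · have h2 : (p c : ℝ) - a c ≤ 1 := by
          have : (p c : ℝ) ≤ a c + 1 := by exact_mod_cast (hp c).2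
          linarith
        have : ((p c : ℝ) - a c) / k ≤ 1 / k := by gcongr
        calc 4 * (((p c : ℝ) - a c) / k) ≤ 4 * (1 / k) := by linarith
          _ = 4 / k := by ring
      · have h2 : (a c : ℝ) ≤ p c := by exact_mod_cast (hp c).1
        have h3 : (0 : ℝ) ≤ (p c : ℝ) - a c := by linarith
        positivity
    have := hηf (s p) ((hmem _).2 (hs p fun c => (hp c).2.trans (a c).2)) (s fun c => a c)
      ((hmem _).2 (hs _ hale)) hd
    rw [← Real.dist_eq]
    exact (dist_le_pi_dist _ _ i).trans_lt this
  refine absurd (hδf _ ((hmem _).2 (hs _ hale))) (not_le.2 ?_)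
  rw [pi_norm_lt_iff hδ]
  intro i
  obtain ⟨p, q, hp, hq, hpq⟩ := ha i
  have hp2 := abs_lt.1 (hdist p (fun c => (hpq c).1) i)
  have hq2 := abs_lt.1 (hdist q (fun c => (hpq c).2) i)
  have hp3 := hF0 i p (fun c => (hpq c).1.2.trans (a c).2) hp
  have hq3 := hF1 i q (fun c => (hpq c).2.2.trans (a c).2) hq
  rw [Real.norm_eq_abs, abs_lt]
  constructor <;> linarith [hp2.1, hp2.2, hq2.1, hq2.2]

/-- A map on the unit cube which on the boundary never points opposite to the position vector
has a zero. -/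
theorem exists_zero_of_boundary_ne_neg {N : ℕ} (G : (Fin N → ℝ) → Fin N → ℝ) (hG : Continuous G)
    (hb : ∀ x, ‖x‖ = 1 → ∀ l : ℝ, 0 ≤ l → G x ≠ -l • x) : ∃ x, ‖x‖ ≤ 1 ∧ G x = 0 := by
  let r : (Fin N → ℝ) → ℝ := fun x => max 1 ‖x‖
  have hr : Continuous r := continuous_const.max continuous_norm
  have hr1 : ∀ x, 1 ≤ r x := fun x => le_max_left _ _
  let P : (Fin N → ℝ) → Fin N → ℝ := fun x => (2 - r x) • G ((r x)⁻¹ • x) + (r x - 1) • x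
  have hP : Continuous P := by
    have h1 : Continuous fun x => (r x)⁻¹ := hr.inv₀ fun x => (by linarith [hr1 x] : r x ≠ 0)
    fun_prop
  have hnorm : ∀ (i : Fin N) (x : Fin N → ℝ), (∀ c, |x c| ≤ 2) → |x i| = 2 → P x = x := by
    intro i x hx hi
    have hx2 : ‖x‖ = 2 := by
      apply le_antisymm
      · exact (pi_norm_le_iff_of_nonneg (by norm_num)).2 fun c => hx c
      · rw [← hi]
        exact norm_le_pi_norm x i
    have hrx : r x = 2 := by simp only [r, hx2]; norm_num
    simp only [P, hrx]
    norm_num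
  obtain ⟨x, hx, hx0⟩ := exists_zero_of_boundary_sign P hP
    (fun i x hx hi => by rw [hnorm i x hx (by rw [hi]; norm_num), hi]; norm_num)
    (fun i x hx hi => by rw [hnorm i x hx (by rw [hi]; norm_num), hi]; norm_num)
  have hx2 : ‖x‖ ≤ 2 := (pi_norm_le_iff_of_nonneg (by norm_num)).2 fun c => hx c
  rcases le_or_gt ‖x‖ 1 with h | h
  · refine ⟨x, h, ?_⟩
    have hrx : r x = 1 := max_eq_left h
    simp only [P, hrx] at hx0
    norm_num at hx0
    exact hx0
  · exfalso
    have hrx : r x = ‖x‖ := max_eq_right h.le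
    simp only [P, hrx] at hx0
    have hpos : 0 < ‖x‖ := by linarith
    rcases hx2.eq_or_lt with h2 | h2
    · rw [h2] at hx0
      norm_num at hx0
      rw [hx0] at h2
      simp at h2
    · refine hb (‖x‖⁻¹ • x) ?_ ((2 - ‖x‖)⁻¹ * (‖x‖ - 1) * ‖x‖) ?_ ?_
      · rw [norm_smul, norm_inv, norm_norm, inv_mul_cancel₀ hpos.ne']
      · have : 0 < 2 - ‖x‖ := by linarith
        have : 0 < ‖x‖ - 1 := by linarith
        positivity
      · have h3 : 2 - ‖x‖ ≠ 0 := by linarith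
        have h4 : (2 - ‖x‖) • G (‖x‖⁻¹ • x) = -((‖x‖ - 1) • x) := eq_neg_of_add_eq_zero_left hx0
        rw [← inv_smul_smul₀ h3 (G (‖x‖⁻¹ • x)), h4, smul_neg, neg_smul, smul_smul, smul_smul,
          mul_assoc _ ‖x‖, mul_inv_cancel₀ hpos.ne', mul_one]

theorem exists_abs_eq_one_of_norm_eq_one {N : ℕ} {z : Fin N → ℝ} (hz : ‖z‖ = 1) :
    ∃ i, |z i| = 1 := by
  by_contra! h
  have : ‖z‖ < 1 := (pi_norm_lt_iff one_pos).2 fun i =>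
    lt_of_le_of_ne (hz ▸ norm_le_pi_norm z i) (h i)
  exact this.ne hz

/-- A vector-valued formula for a degree one map from the cube modulo its boundary to the
sphere of the sup norm. -/
noncomputable def sphereWrap {n : ℕ} (w : Fin n → ℝ) : Fin (n + 1) → ℝ :=
  Fin.cons (1 - 2 * ‖w‖) ((1 - ‖w‖) • w)

theorem continuous_sphereWrap {n : ℕ} : Continuous (sphereWrap : (Fin n → ℝ) → _) := by
  refine continuous_pi fun i => ?_
  refine Fin.cases ?_ (fun i => ?_) i
  · simp only [sphereWrap, Fin.cons_zero]
    fun_prop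
  · simp only [sphereWrap, Fin.cons_succ, Pi.smul_apply]
    fun_prop

theorem sphereWrap_ne_zero {n : ℕ} (w : Fin n → ℝ) : sphereWrap w ≠ 0 := by
  intro h
  have h0 := congrFun h 0
  simp only [sphereWrap, Fin.cons_zero, Pi.zero_apply] at h0
  have h1 : ‖w‖ = 1 / 2 := by linarith
  have hw : (1 - ‖w‖) • w = 0 := funext fun i => by
    have := congrFun h i.succ
    simpa only [sphereWrap, Fin.cons_succ, Pi.zero_apply] using this
  rw [h1] at hw
  have : w = 0 := (smul_eq_zero.1 hw).resolve_left (by norm_num)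
  rw [this] at h1
  norm_num at h1

theorem sphereWrap_of_norm_eq_one {n : ℕ} {w : Fin n → ℝ} (hw : ‖w‖ = 1) :
    sphereWrap w = Fin.cons (-1) 0 := by
  rw [sphereWrap, hw]
  norm_num

theorem norm_cons_neg_one {n : ℕ} : ‖(Fin.cons (-1) 0 : Fin (n + 1) → ℝ)‖ = 1 := by
  apply le_antisymm
  · refine (pi_norm_le_iff_of_nonneg zero_le_one).2 fun i => ?_
    refine Fin.cases ?_ (fun i => ?_) i <;> simp
  · have := norm_le_pi_norm (Fin.cons (-1) 0 : Fin (n + 1) → ℝ) 0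
    simpa using this

/-- The normalisation of `sphereWrap` to the unit sphere of the sup norm. -/
noncomputable def sphereLoop {n : ℕ} (w : Fin n → ℝ) : Fin (n + 1) → ℝ :=
  ‖sphereWrap w‖⁻¹ • sphereWrap w

theorem continuous_sphereLoop {n : ℕ} : Continuous (sphereLoop : (Fin n → ℝ) → _) := by
  have h := continuous_sphereWrap (n := n)
  exact (h.norm.inv₀ fun w => norm_ne_zero_iff.2 (sphereWrap_ne_zero w)).smul h

theorem norm_sphereLoop {n : ℕ} (w : Fin n → ℝ) : ‖sphereLoop w‖ = 1 := by
  rw [sphereLoop, norm_smul, norm_inv, norm_norm,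
    inv_mul_cancel₀ (norm_ne_zero_iff.2 (sphereWrap_ne_zero w))]

theorem sphereLoop_of_norm_eq_one {n : ℕ} {w : Fin n → ℝ} (hw : ‖w‖ = 1) :
    sphereLoop w = Fin.cons (-1) 0 := by
  rw [sphereLoop, sphereWrap_of_norm_eq_one hw, norm_cons_neg_one, inv_one, one_smul]

theorem sphereLoop_ne_neg {n : ℕ} (w : Fin n → ℝ) (l : ℝ) (hl : 0 ≤ l) :
    sphereLoop w ≠ -l • (Fin.cons 1 w : Fin (n + 1) → ℝ) := by
  intro h
  have hpos : 0 < ‖sphereWrap w‖ := norm_pos_iff.2 (sphereWrap_ne_zero w)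
  have h2 : sphereWrap w = -(‖sphereWrap w‖ * l) • (Fin.cons 1 w : Fin (n + 1) → ℝ) := by
    rw [show -(‖sphereWrap w‖ * l) = ‖sphereWrap w‖ * -l by ring, mul_smul, ← h, sphereLoop, smul_smul, mul_inv_cancel₀ hpos.ne',
      one_smul]
  set L := ‖sphereWrap w‖ * l with hL
  have hL0 : 0 ≤ L := by positivity
  have h0 := congrFun h2 0
  simp only [sphereWrap, Fin.cons_zero, Pi.smul_apply, smul_eq_mul, mul_one] at h0
  have hw : (1 - ‖w‖ + L) • w = 0 := funext fun i => by
    have := congrFun h2 i.succ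
    simp only [sphereWrap, Fin.cons_succ, Pi.smul_apply, smul_eq_mul] at this
    simp only [Pi.smul_apply, smul_eq_mul, Pi.zero_apply]
    linarith
  rcases smul_eq_zero.1 hw with h3 | h3
  · linarith
  · rw [h3, norm_zero] at h0
    linarith

/-- The boundary of the cube `[-1, 1]^J` placed around the unit cube in the coordinates `J`. -/
noncomputable def cubeEmbedding {m N : ℕ} {J : Finset (Fin m)} (e : Fin N ≃ J) (z : Fin N → ℝ) :
    Fin m → ℝ :=
  fun k => if h : k ∈ J then 1 / 2 + z (e.symm ⟨k, h⟩) / 2 else 0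

theorem continuous_cubeEmbedding {m N : ℕ} {J : Finset (Fin m)} (e : Fin N ≃ J) :
    Continuous (cubeEmbedding e) := by
  refine continuous_pi fun k => ?_
  unfold cubeEmbedding
  split_ifs <;> fun_prop

theorem cubeEmbedding_apply {m N : ℕ} {J : Finset (Fin m)} (e : Fin N ≃ J) (z : Fin N → ℝ)
    (i : Fin N) : cubeEmbedding e z (e i) = 1 / 2 + z i / 2 := by
  simp [cubeEmbedding]

theorem cubeEmbedding_mem {m N : ℕ} {K : Finset (Finset (Fin m))} {J : Finset (Fin m)}
    (hJ : ∀ I ⊂ J, I ∈ K) (e : Fin N ≃ J) {z : Fin N → ℝ} (hz : ‖z‖ = 1) :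
    ∃ I ∈ K, ∀ k, k ∉ I → ∃ n : ℤ, cubeEmbedding e z k = n := by
  obtain ⟨i, hi⟩ := exists_abs_eq_one_of_norm_eq_one hz
  refine ⟨J.erase (e i), hJ _ (Finset.erase_ssubset (e i).2), fun k hk => ?_⟩
  by_cases hkJ : k ∈ J
  · have : k = e i := by
      by_contra h
      exact hk (Finset.mem_erase.2 ⟨h, hkJ⟩)
    rw [this, cubeEmbedding_apply]
    rcases (abs_eq zero_le_one).1 hi with h | h
    · exact ⟨1, by rw [h]; norm_num⟩
    · exact ⟨0, by rw [h]; norm_num⟩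
  · exact ⟨0, by simp [cubeEmbedding, hkJ]⟩

/-- If `J` is a minimal non-face of `K` with `n + 1` vertices then `π_n(L_K)` is non-trivial. -/
theorem not_subsingleton_homotopyGroup_of_minimal_nonface {m n : ℕ} {K : Finset (Finset (Fin m))}
    (hdown : ∀ I ∈ K, ∀ J ⊆ I, J ∈ K) {J : Finset (Fin m)} (hJK : J ∉ K)
    (hJ : ∀ I ⊂ J, I ∈ K) (hcard : J.card = n + 1) :
    ∃ y : realPolyhedralProduct m K,
      ¬ Subsingleton (HomotopyGroup (Fin n) (realPolyhedralProduct m K) y) := by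
  let e : Fin (n + 1) ≃ J := (J.equivFinOfCardEq hcard).symm
  let y₀ : realPolyhedralProduct m K :=
    ⟨cubeEmbedding e (Fin.cons (-1) 0), cubeEmbedding_mem hJ e norm_cons_neg_one⟩
  refine ⟨y₀, fun hsub => ?_⟩
  let centre : (Fin n → unitInterval) → Fin n → ℝ := fun q c => 2 * (q c : ℝ) - 1
  have hcentre : Continuous centre := by
    refine continuous_pi fun c => ?_
    simp only [centre]
    fun_prop
  let g : GenLoop (Fin n) (realPolyhedralProduct m K) y₀ :=
    ⟨⟨fun q => ⟨cubeEmbedding e (sphereLoop (centre q)),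
        cubeEmbedding_mem hJ e (norm_sphereLoop _)⟩,
      ((continuous_cubeEmbedding e).comp (continuous_sphereLoop.comp hcentre)).subtype_mk _⟩, by
      rintro q ⟨i, hi⟩
      have hq : ‖centre q‖ = 1 := by
        apply le_antisymm
        · refine (pi_norm_le_iff_of_nonneg zero_le_one).2 fun c => ?_
          have := (q c).2
          simp only [centre, Real.norm_eq_abs, abs_le]
          constructor <;> linarith [this.1, this.2]
        · have := norm_le_pi_norm (centre q) i
          rcases hi with hi | hi <;> simp [centre, hi] at this <;> norm_num at this <;> exact this
      simp [y₀, sphereLoop_of_norm_eq_one hq]⟩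
  have hhom : GenLoop.Homotopic g GenLoop.const := Quotient.exact (hsub.elim _ _)
  obtain ⟨H⟩ := hhom
  let T : (Fin (n + 1) → ℝ) → unitInterval × (Fin n → unitInterval) := fun x =>
    (Set.projIcc 0 1 zero_le_one ((1 - x 0) / 2),
      fun c => Set.projIcc 0 1 zero_le_one ((x c.succ + 1) / 2))
  have hT : Continuous T := by
    refine Continuous.prodMk ?_ (continuous_pi fun c => ?_)
    · exact continuous_projIcc.comp (by fun_prop)
    · exact continuous_projIcc.comp (by fun_prop)
  let G : (Fin (n + 1) → ℝ) → Fin (n + 1) → ℝ := fun x i => 2 * (H (T x)).1 (e i) - 1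
  have hG : Continuous G := by
    refine continuous_pi fun i => ?_
    have h1 : Continuous fun x => (H (T x)).1 (e i) :=
      (continuous_apply _).comp (continuous_subtype_val.comp (H.continuous.comp hT))
    exact (continuous_const.mul h1).sub continuous_const
  have hGy : ∀ x z, (H (T x)).1 = cubeEmbedding e z → G x = z := by
    intro x z h
    funext i
    simp only [G, h, cubeEmbedding_apply]
    ring
  have hG1 : ∀ x : Fin (n + 1) → ℝ, ‖x‖ = 1 → x 0 = 1 → G x = sphereLoop (fun c => x c.succ) := by
    intro x hx h0
    apply hGy
    have hx0 : Set.projIcc (0 : ℝ) 1 zero_le_one ((1 - x 0) / 2) = 0 := by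
      rw [h0]
      norm_num
    have : T x = (0, fun c => Set.projIcc 0 1 zero_le_one ((x c.succ + 1) / 2)) :=
      Prod.ext hx0 rfl
    rw [this]
    have h2 : H (0, fun c => Set.projIcc 0 1 zero_le_one ((x c.succ + 1) / 2)) =
      g fun c => Set.projIcc 0 1 zero_le_one ((x c.succ + 1) / 2) := H.apply_zero _
    rw [h2]
    change cubeEmbedding e (sphereLoop (centre _)) = _
    congr 2
    funext c
    have hc : |x c.succ| ≤ 1 := hx ▸ norm_le_pi_norm x c.succ
    rw [abs_le] at hc
    simp only [centre]
    rw [Set.projIcc_of_mem _ (show (x c.succ + 1) / 2 ∈ Set.Icc (0 : ℝ) 1 from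
      ⟨by linarith [hc.1], by linarith [hc.2]⟩)]
    ring
  have hG2 : ∀ x : Fin (n + 1) → ℝ, ‖x‖ = 1 → x 0 ≠ 1 → G x = Fin.cons (-1) 0 := by
    intro x hx h0
    apply hGy
    obtain ⟨i, hi⟩ := exists_abs_eq_one_of_norm_eq_one hx
    revert hi
    refine Fin.cases (fun hi => ?_) (fun i hi => ?_) i
    · have h1 : x 0 = -1 := ((abs_eq zero_le_one).1 hi).resolve_left h0
      have hx0 : Set.projIcc (0 : ℝ) 1 zero_le_one ((1 - x 0) / 2) = 1 := by
        rw [h1]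
        norm_num
      have : T x = (1, fun c => Set.projIcc 0 1 zero_le_one ((x c.succ + 1) / 2)) :=
        Prod.ext hx0 rfl
      rw [this]
      have h2 : H (1, fun c => Set.projIcc 0 1 zero_le_one ((x c.succ + 1) / 2)) = y₀ :=
        H.apply_one _
      rw [h2]
    · have hb : (T x).2 ∈ Cube.boundary (Fin n) := by
        refine ⟨i, ?_⟩
        rcases (abs_eq zero_le_one).1 hi with h | h
        · right
          simp only [T, h]
          norm_num
        · left
          simp only [T, h]
          norm_num
      have h2 : H ((T x).1, (T x).2) = y₀ := by
        rw [H.eq_fst _ hb]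
        exact g.2 _ hb
      rw [Prod.mk.eta] at h2
      rw [h2]
  obtain ⟨x, -, hx⟩ := exists_zero_of_boundary_ne_neg G hG (by
    intro x hx l hl h
    by_cases h0 : x 0 = 1
    · rw [hG1 x hx h0] at h
      refine sphereLoop_ne_neg _ l hl (h.trans ?_)
      congr 1
      funext i
      refine Fin.cases ?_ (fun i => ?_) i <;> simp [h0]
    · rw [hG2 x hx h0] at h
      have ha := congrFun h 0
      simp only [Fin.cons_zero, Pi.smul_apply, smul_eq_mul] at ha
      have hl0 : l ≠ 0 := by
        rintro rfl
        norm_num at ha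
      have hz : ∀ i : Fin n, x i.succ = 0 := by
        intro i
        have := congrFun h i.succ
        simp only [Fin.cons_succ, Pi.smul_apply, smul_eq_mul, Pi.zero_apply] at this
        have := (mul_eq_zero.1 this.symm).resolve_left (neg_ne_zero.2 hl0)
        exact this
      obtain ⟨i, hi⟩ := exists_abs_eq_one_of_norm_eq_one hx
      revert hi
      refine Fin.cases (fun hi => ?_) (fun i hi => ?_) i
      · have h1 : x 0 = -1 := ((abs_eq zero_le_one).1 hi).resolve_left h0
        rw [h1] at ha
        linarith
      · rw [hz i] at hi
        norm_num at hi)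
  obtain ⟨I, hI, h_int⟩ := (H (T x)).2
  have hJI : ¬ J ⊆ I := fun h => hJK (hdown I hI J h)
  obtain ⟨k, hkJ, hkI⟩ := Finset.not_subset.1 hJI
  obtain ⟨a, ha⟩ := h_int k hkI
  have h1 := congrFun hx (e.symm ⟨k, hkJ⟩)
  simp only [G, Equiv.apply_symm_apply, Pi.zero_apply] at h1
  rw [ha] at h1
  have h2 : (2 * a : ℤ) = 1 := by
    have : (2 * a : ℝ) = 1 := by linarith
    exact_mod_cast this
  omega

theorem flag_of_subsingleton_homotopyGroup (m : ℕ) (K : Finset (Finset (Fin m)))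
    (hdown : ∀ I ∈ K, ∀ J ⊆ I, J ∈ K) (hempty : (∅ : Finset (Fin m)) ∈ K)
    (hsingle : ∀ i : Fin m, ({i} : Finset (Fin m)) ∈ K)
    (h : ∀ (y : realPolyhedralProduct m K) (n : ℕ), 2 ≤ n →
      Subsingleton (HomotopyGroup (Fin n) (realPolyhedralProduct m K) y))
    (J : Finset (Fin m)) (hJ : ∀ i ∈ J, ∀ j ∈ J, i ≠ j → ({i, j} : Finset (Fin m)) ∈ K) :
    J ∈ K := by
  induction J using Finset.strongInduction with
  | H J ih =>
    by_contra hJK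
    have hcard : 3 ≤ J.card := by
      by_contra! hlt
      interval_cases hc : J.card
      · rw [Finset.card_eq_zero.1 hc] at hJK
        exact hJK hempty
      · obtain ⟨i, rfl⟩ := Finset.card_eq_one.1 hc
        exact hJK (hsingle i)
      · obtain ⟨i, j, hij, rfl⟩ := Finset.card_eq_two.1 hc
        exact hJK (hJ i (by simp) j (by simp) hij)
    obtain ⟨y, hy⟩ := not_subsingleton_homotopyGroup_of_minimal_nonface hdown hJK
      (fun I hI => ih I hI fun i hi j hj => hJ i (hI.1 hi) j (hI.1 hj))
      (show J.card = (J.card - 1) + 1 by omega)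
    exact hy (h y _ (by omega))

open Classical in
/-- Put the letter `s` on the `i`-th stack and the letter `0` on all stacks belonging to vertices
that are not adjacent to `i`. -/
noncomputable def pilingPush {ι : Type*} (G : SimpleGraph ι) (i : ι) (s : SignType)
    (v : ι → List SignType) : ι → List SignType :=
  fun k => if k = i then s :: v k else if G.Adj i k then v k else 0 :: v k

open Classical in
/-- Remove the top letter from the `i`-th stack and from all stacks belonging to vertices
that are not adjacent to `i`. -/
noncomputable def pilingPop {ι : Type*} (G : SimpleGraph ι) (i : ι)
    (v : ι → List SignType) : ι → List SignType :=
  fun k => if G.Adj i k then v k else (v k).tail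

/-- The top letter of the `i`-th stack. -/
def pilingTop {ι : Type*} (v : ι → List SignType) (i : ι) : SignType := (v i).headD 0

theorem pilingPop_push {ι : Type*} (G : SimpleGraph ι) (i : ι) (s : SignType)
    (v : ι → List SignType) : pilingPop G i (pilingPush G i s v) = v := by
  funext k
  by_cases hk : k = i
  · subst hk
    simp [pilingPop, pilingPush]
  · by_cases h : G.Adj i k <;> simp [pilingPop, pilingPush, hk, h]

theorem pilingTop_push_self {ι : Type*} (G : SimpleGraph ι) (i : ι) (s : SignType)
    (v : ι → List SignType) : pilingTop (pilingPush G i s v) i = s := by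
  simp [pilingTop, pilingPush]

theorem pilingTop_push_of_adj {ι : Type*} {G : SimpleGraph ι} {i j : ι} (h : G.Adj i j)
    (s : SignType) (v : ι → List SignType) :
    pilingTop (pilingPush G i s v) j = pilingTop v j := by
  simp [pilingTop, pilingPush, h, h.ne']

theorem pilingTop_push_of_not_adj {ι : Type*} {G : SimpleGraph ι} {i j : ι} (hij : j ≠ i)
    (h : ¬ G.Adj i j) (s : SignType) (v : ι → List SignType) :
    pilingTop (pilingPush G i s v) j = 0 := by
  simp [pilingTop, pilingPush, h, hij]

theorem pilingPush_comm {ι : Type*} {G : SimpleGraph ι} {i j : ι} (h : G.Adj i j)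
    (s t : SignType) (v : ι → List SignType) :
    pilingPush G i s (pilingPush G j t v) = pilingPush G j t (pilingPush G i s v) := by
  funext k
  by_cases hi : k = i
  · subst hi
    simp [pilingPush, h.symm, h.ne]
  · by_cases hj : k = j
    · subst hj
      simp [pilingPush, h.ne', h]
    · by_cases h1 : G.Adj i k <;> by_cases h2 : G.Adj j k <;> simp [pilingPush, hi, hj, h1, h2]

/-- The pilings that arise from reduced words in the right-angled Artin group of `G`. -/
inductive IsPiling {ι : Type*} (G : SimpleGraph ι) : (ι → List SignType) → Prop
  | empty : IsPiling G fun _ => []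
  | push {v : ι → List SignType} (hv : IsPiling G v) {s : SignType} (hs : s ≠ 0) {i : ι}
      (hi : pilingTop v i ≠ -s) : IsPiling G (pilingPush G i s v)

theorem IsPiling.exists_eq_push {ι : Type*} {G : SimpleGraph ι} {v : ι → List SignType}
    (hv : IsPiling G v) {i : ι} (hi : pilingTop v i ≠ 0) :
    ∃ w, IsPiling G w ∧ pilingTop w i ≠ -pilingTop v i ∧
      v = pilingPush G i (pilingTop v i) w := by
  induction hv with
  | empty => simp [pilingTop] at hi
  | @push v hv s hs j hj ih =>
    by_cases hij : i = j
    · subst hij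
      rw [pilingTop_push_self]
      exact ⟨v, hv, hj, rfl⟩
    · by_cases hadj : G.Adj j i
      · rw [pilingTop_push_of_adj hadj] at hi ⊢
        obtain ⟨w, hw, hwi, hvw⟩ := ih hi
        have hjw : pilingTop v j = pilingTop w j := by
          conv_lhs => rw [hvw]
          exact pilingTop_push_of_adj hadj.symm _ _
        refine ⟨pilingPush G j s w, hw.push hs (hjw ▸ hj), ?_, ?_⟩
        · rwa [pilingTop_push_of_adj hadj]
        · conv_lhs => rw [hvw]
          exact pilingPush_comm hadj _ _ _
      · exact absurd (pilingTop_push_of_not_adj hij hadj s v) hi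

theorem IsPiling.pop {ι : Type*} {G : SimpleGraph ι} {v : ι → List SignType}
    (hv : IsPiling G v) {i : ι} (hi : pilingTop v i ≠ 0) : IsPiling G (pilingPop G i v) := by
  obtain ⟨w, hw, -, h⟩ := hv.exists_eq_push hi
  rw [h, pilingPop_push]
  exact hw

/-- The set of pilings of a graph; it is the vertex set of the universal cover of the real
polyhedral product of the associated flag complex. -/
def Piling {ι : Type*} (G : SimpleGraph ι) : Type _ := { v : ι → List SignType // IsPiling G v }

namespace Piling

variable {ι : Type*} {G : SimpleGraph ι}

/-- The top letter of the `i`-th stack of a piling. -/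
def top (v : Piling G) (i : ι) : SignType := pilingTop v.1 i

theorem exists_eq_push (v : Piling G) {i : ι} (hi : v.top i ≠ 0) :
    ∃ w : Piling G, w.top i ≠ -v.top i ∧ v.1 = pilingPush G i (v.top i) w.1 := by
  obtain ⟨w, hw, h1, h2⟩ := v.2.exists_eq_push hi
  exact ⟨⟨w, hw⟩, h1, h2⟩

open Classical in
/-- Multiplication of a piling by a letter. -/
noncomputable def act (i : ι) (s : SignType) (v : Piling G) : Piling G :=
  if hs : s = 0 then v
  else if h : v.top i = -s then ⟨pilingPop G i v.1, v.2.pop (by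
    change v.top i ≠ 0
    rw [h]
    simpa using hs)⟩
  else ⟨pilingPush G i s v.1, v.2.push hs h⟩

theorem act_of_eq_zero {i : ι} {s : SignType} (hs : s = 0) (v : Piling G) : act i s v = v := by
  simp [act, hs]

theorem act_of_top_ne {i : ι} {s : SignType} (hs : s ≠ 0) {v : Piling G} (h : v.top i ≠ -s) :
    (act i s v).1 = pilingPush G i s v.1 := by
  simp [act, hs, h]

theorem act_eq_of_eq_push {i : ι} {s : SignType} (hs : s ≠ 0) {v w : Piling G}
    (h : v.1 = pilingPush G i s w.1) : act i (-s) v = w := by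
  have : v.top i = s := by
    rw [top, h, pilingTop_push_self]
  apply Subtype.ext
  simp [act, hs, this, h, pilingPop_push]

theorem act_neg_act (i : ι) (s : SignType) (v : Piling G) : act i (-s) (act i s v) = v := by
  by_cases hs : s = 0
  · simp [act, hs]
  by_cases h : v.top i = -s
  · have h0 : v.top i ≠ 0 := by
      rw [h]
      simpa using hs
    obtain ⟨w, hw, hvw⟩ := v.exists_eq_push h0
    rw [h] at hvw hw
    have h1 : act i s v = w := by
      have := act_eq_of_eq_push (by simpa using hs) hvw
      rwa [neg_neg] at this
    rw [h1]
    apply Subtype.ext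
    rw [hvw, act_of_top_ne (by simpa using hs) hw]
  · exact act_eq_of_eq_push hs (act_of_top_ne hs h)

theorem top_act_of_adj {i j : ι} (h : G.Adj i j) (s : SignType) (v : Piling G) :
    (act i s v).top j = v.top j := by
  by_cases h1 : s = 0
  · simp [act_of_eq_zero h1]
  by_cases h2 : v.top i = -s
  · simp [act, h1, h2]
    simp [top, pilingTop, pilingPop, h]
  · rw [top, act_of_top_ne h1 h2]
    exact pilingTop_push_of_adj h s v.1

theorem act_comm_of_top_ne {i j : ι} (h : G.Adj i j) {s t : SignType} (hs : s ≠ 0) (ht : t ≠ 0)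
    {v : Piling G} (hi : v.top i ≠ -s) (hj : v.top j ≠ -t) :
    act i s (act j t v) = act j t (act i s v) := by
  apply Subtype.ext
  rw [act_of_top_ne hs (by rwa [top_act_of_adj h.symm]), act_of_top_ne ht hj,
    act_of_top_ne ht (by rwa [top_act_of_adj h]), act_of_top_ne hs hi, pilingPush_comm h]

theorem top_act_self {i : ι} {s : SignType} (hs : s ≠ 0) {v : Piling G} (h : v.top i = -s) :
    (act i s v).top i ≠ s := by
  have h0 : v.top i ≠ 0 := by
    rw [h]
    simpa using hs
  obtain ⟨w, hw, hvw⟩ := v.exists_eq_push h0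
  rw [h] at hvw hw
  have h1 : act i s v = w := by
    have := act_eq_of_eq_push (by simpa using hs) hvw
    rwa [neg_neg] at this
  rw [h1]
  simpa using hw

theorem act_comm {i j : ι} (h : G.Adj i j) (s t : SignType) (v : Piling G) :
    act i s (act j t v) = act j t (act i s v) := by
  by_cases hs : s = 0
  · simp [act_of_eq_zero hs]
  by_cases ht : t = 0
  · simp [act_of_eq_zero ht]
  have hs' : -s ≠ 0 := by simpa using hs
  have ht' : -t ≠ 0 := by simpa using ht
  have key : ∀ {i j : ι} (_ : G.Adj i j) {s t : SignType} (_ : s ≠ 0) (_ : t ≠ 0)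
      (v : Piling G) (_ : v.top j ≠ -t), act i s (act j t v) = act j t (act i s v) := by
    intro i j h s t hs ht v hj
    by_cases hi : v.top i = -s
    · have h2 := act_comm_of_top_ne h (s := -s) (t := t) (by simpa using hs) ht
        (v := act i s v) (by rw [neg_neg]; exact top_act_self hs hi)
        (by rwa [top_act_of_adj h])
      rw [act_neg_act] at h2
      rw [← h2]
      simpa using act_neg_act i (-s) (act j t (act i s v))
    · exact act_comm_of_top_ne h hs ht hi hj
  by_cases hj : v.top j = -t
  · have h2 := key h (s := s) (t := -t) hs ht' (act j t v)
      (by rw [neg_neg]; exact top_act_self ht hj)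
    rw [act_neg_act] at h2
    rw [h2]
    have h3 := act_neg_act j (-t) (act i s (act j t v))
    rw [neg_neg] at h3
    exact h3.symm
  · exact key h hs ht v hj

/-- Multiplication by the `i`-th generator as a permutation of the set of pilings. -/
noncomputable def gen (i : ι) : Equiv.Perm (Piling G) where
  toFun := act i 1
  invFun := act i (-1)
  left_inv := act_neg_act i 1
  right_inv v := by simpa using act_neg_act i (-1) v

theorem commute_gen {i j : ι} (h : G.Adj i j) : Commute (gen i : Equiv.Perm (Piling G)) (gen j) :=
  Equiv.ext fun v => act_comm h 1 1 v

theorem adj_of_top_ne_zero (v : Piling G) {i j : ι} (hi : v.top i ≠ 0) (hj : v.top j ≠ 0)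
    (hij : i ≠ j) : G.Adj i j := by
  obtain ⟨w, -, hvw⟩ := v.exists_eq_push hi
  by_contra hadj
  apply hj
  rw [top, hvw]
  exact pilingTop_push_of_not_adj hij.symm hadj _ _

/-- The number of non-zero letters of a piling. -/
def length [Fintype ι] (v : Piling G) : ℕ := ∑ i, (v.1 i).countP (· ≠ 0)

/-- The signed count of the letters on the stacks of a piling. -/
def height (v : Piling G) (i : ι) : ℤ := ((v.1 i).map fun s => (s : ℤ)).sum

theorem length_of_eq_push [Fintype ι] {v w : Piling G} {i : ι} {s : SignType} (hs : s ≠ 0)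
    (h : v.1 = pilingPush G i s w.1) : v.length = w.length + 1 := by
  classical
  unfold length
  rw [h, ← Finset.add_sum_erase _ _ (Finset.mem_univ i),
    ← Finset.add_sum_erase _ (fun i => (w.1 i).countP (· ≠ 0)) (Finset.mem_univ i)]
  have h1 : (pilingPush G i s w.1 i).countP (· ≠ 0) = (w.1 i).countP (· ≠ 0) + 1 := by
    simp [pilingPush, hs]
  have h2 : ∀ k ∈ Finset.univ.erase i, (pilingPush G i s w.1 k).countP (· ≠ 0) =
      (w.1 k).countP (· ≠ 0) := by
    intro k hk
    have hki := Finset.ne_of_mem_erase hk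
    by_cases hadj : G.Adj i k <;> simp [pilingPush, hki, hadj]
  rw [h1, Finset.sum_congr rfl h2]
  ring

theorem height_of_eq_push [DecidableEq ι] {v w : Piling G} {i : ι} {s : SignType}
    (h : v.1 = pilingPush G i s w.1) : v.height = w.height + Pi.single i (s : ℤ) := by
  funext k
  rw [height, h, Pi.add_apply, height]
  by_cases hk : k = i
  · subst hk
    simp [pilingPush, add_comm]
  · by_cases hadj : G.Adj i k <;> simp [pilingPush, hk, hadj]

theorem act_cases [DecidableEq ι] [Fintype ι] (i : ι) {s : SignType} (hs : s ≠ 0) (v : Piling G) :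
    (v.top i = -s ∧ v.length = (act i s v).length + 1 ∨ (act i s v).length = v.length + 1) ∧
      (act i s v).height = v.height + Pi.single i (s : ℤ) := by
  by_cases h : v.top i = -s
  · have hs' : -s ≠ 0 := by simpa using hs
    have h2 : v.1 = pilingPush G i (-s) (act i s v).1 := by
      have h3 := act_of_top_ne hs' (v := act i s v) (by rw [neg_neg]; exact top_act_self hs h)
      rwa [act_neg_act] at h3
    refine ⟨Or.inl ⟨h, length_of_eq_push hs' h2⟩, ?_⟩
    rw [height_of_eq_push h2, add_assoc, ← Pi.single_add]
    simp
  · have h2 := act_of_top_ne hs h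
    exact ⟨Or.inr (length_of_eq_push hs h2), height_of_eq_push h2⟩

theorem length_act_neg_top [Fintype ι] {v : Piling G} {i : ι} (hi : v.top i ≠ 0) :
    v.length = (act i (-v.top i) v).length + 1 := by
  obtain ⟨w, -, h⟩ := v.exists_eq_push hi
  rw [act_eq_of_eq_push hi h]
  exact length_of_eq_push hi h

theorem finite_setOf_length_le [Fintype ι] (k : ℕ) : {v : Piling G | v.length ≤ k}.Finite := by
  classical
  induction k with
  | zero =>
    refine (Set.finite_singleton (⟨_, IsPiling.empty⟩ : Piling G)).subset ?_
    rintro ⟨v, hv⟩ h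
    cases hv with
    | empty => rfl
    | @push w hw s hs i hi =>
      have := length_of_eq_push (v := ⟨_, hw.push hs hi⟩) (w := ⟨w, hw⟩) hs rfl
      have h : Piling.length _ ≤ 0 := h
      omega
  | succ k ih =>
    refine ((Set.finite_singleton (⟨_, IsPiling.empty⟩ : Piling G)).union
      (Set.finite_iUnion fun p : ι × SignType => ih.image (act p.1 p.2))).subset ?_
    rintro ⟨v, hv⟩ h
    cases hv with
    | empty => exact Or.inl rfl
    | @push w hw s hs i hi =>
      have := length_of_eq_push (v := ⟨_, hw.push hs hi⟩) (w := ⟨w, hw⟩) hs rfl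
      have h : Piling.length _ ≤ k + 1 := h
      refine Or.inr (Set.mem_iUnion.2 ⟨(i, s), ⟨⟨w, hw⟩, ?_, ?_⟩⟩)
      · change Piling.length _ ≤ k
        omega
      · exact Subtype.ext (act_of_top_ne (v := ⟨w, hw⟩) hs hi)

theorem exists_top_ne_zero_or (v : Piling G) :
    v = ⟨_, IsPiling.empty⟩ ∨ ∃ i, v.top i ≠ 0 := by
  obtain ⟨v, hv⟩ := v
  cases hv with
  | empty => exact Or.inl rfl
  | @push w hw s hs i hi => exact Or.inr ⟨i, fun h => hs ((pilingTop_push_self G i s w).symm.trans h)⟩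

section Fin

variable {m : ℕ} {G : SimpleGraph (Fin m)}

theorem gen_zpow_signType (i : Fin m) (s : SignType) (v : Piling G) :
    (gen i ^ (s : ℤ)) v = act i s v := by
  cases s
  · simp [act_of_eq_zero]
  · simp only [SignType.neg_eq_neg_one, SignType.coe_neg, SignType.coe_one, zpow_neg, zpow_one]
    rfl
  · simp only [SignType.pos_eq_one, SignType.coe_one, zpow_one]
    rfl

/-- Translation of pilings by integer vectors; this is only additive on vectors supported on
a common clique. -/
noncomputable def shift (c : Fin m → ℤ) : Equiv.Perm (Piling G) :=
  ((List.finRange m).map fun i => gen i ^ c i).prod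

theorem shift_zero : shift (G := G) 0 = 1 := by
  simp [shift]

theorem list_prod_mul_of_commute {M ι : Type*} [Monoid M] (f g : ι → M)
    (h : ∀ i j, Commute (f i) (g j)) (L : List ι) :
    (L.map fun i => f i * g i).prod = (L.map f).prod * (L.map g).prod := by
  induction L with
  | nil => simp
  | cons i L ih =>
    have : Commute (g i) (L.map f).prod := by
      apply Commute.list_prod_right
      simp only [List.mem_map]
      rintro _ ⟨j, -, rfl⟩
      exact (h j i).symm
    simp only [List.map_cons, List.prod_cons, ih]
    rw [mul_assoc, ← mul_assoc (g i), this.eq]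
    simp only [mul_assoc]

theorem shift_add {c d : Fin m → ℤ} (h : ∀ i j, c i ≠ 0 → d j ≠ 0 → i ≠ j → G.Adj i j) :
    shift (G := G) (c + d) = shift c * shift d := by
  unfold shift
  rw [← list_prod_mul_of_commute]
  · simp [zpow_add]
  · intro i j
    by_cases hc : c i = 0
    · simp [hc]
    by_cases hd : d j = 0
    · simp [hd]
    by_cases hij : i = j
    · subst hij
      exact (Commute.refl _).zpow_zpow _ _
    · exact (commute_gen (h i j hc hd hij)).zpow_zpow _ _

theorem shift_single (i : Fin m) (s : SignType) (v : Piling G) :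
    shift (Pi.single i (s : ℤ)) v = act i s v := by
  rw [← gen_zpow_signType]
  congr 1
  unfold shift
  have : ∀ L : List (Fin m), L.Nodup →
      (L.map fun j => (gen j : Equiv.Perm (Piling G)) ^ (Pi.single i (s : ℤ) : Fin m → ℤ) j).prod =
        if i ∈ L then gen i ^ (s : ℤ) else 1 := by
    intro L hL
    induction L with
    | nil => simp
    | cons j L ih =>
      obtain ⟨hj, hL⟩ := List.nodup_cons.1 hL
      rw [List.map_cons, List.prod_cons, ih hL]
      by_cases hij : i = j
      · subst hij
        simp [hj]
      · simp [hij, Ne.symm hij]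
  rw [this _ (List.nodup_finRange m)]
  simp

theorem gen_zpow_induction {i : Fin m} {P : ℤ → Piling G → Prop} {v : Piling G} (h0 : P 0 v)
    (hs : ∀ c w (s : SignType), s ≠ 0 → (c + (s : ℤ)).natAbs = c.natAbs + 1 → P c w → P (c + (s : ℤ)) (act i s w))
    (c : ℤ) : P c ((gen i ^ c) v) := by
  induction c with
  | zero => simpa using h0
  | succ n ih =>
    have h1 := hs n _ 1 (by decide) (by simp; omega) ih
    have h2 : (gen i ^ ((n : ℤ) + 1)) v = act i 1 ((gen i ^ (n : ℤ)) v) := by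
      rw [add_comm, zpow_add, zpow_one]
      rfl
    rw [h2]
    simpa using h1
  | pred n ih =>
    have h1 := hs (-n) _ (-1) (by decide) (by simp; omega) ih
    have h2 : (gen i ^ (-(n : ℤ) - 1)) v = act i (-1) ((gen i ^ (-(n : ℤ))) v) := by
      rw [sub_eq_neg_add, zpow_add, zpow_neg_one]
      rfl
    rw [h2]
    simpa [sub_eq_add_neg] using h1

theorem height_gen_zpow (i : Fin m) (c : ℤ) (v : Piling G) :
    ((gen i ^ c) v).height = v.height + Pi.single i c := by
  refine gen_zpow_induction (P := fun c w => w.height = v.height + Pi.single i c) ?_ ?_ c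
  · simp
  · intro c w s hs _ h
    rw [(act_cases i hs w).2, h, Pi.single_add, add_assoc]

theorem length_gen_zpow_le (i : Fin m) (c : ℤ) (v : Piling G) :
    ((gen i ^ c) v).length ≤ v.length + c.natAbs := by
  refine gen_zpow_induction (P := fun c w => w.length ≤ v.length + c.natAbs) ?_ ?_ c
  · simp
  · intro c w s hs hc h
    have := (act_cases i hs w).1
    omega

theorem height_shift (c : Fin m → ℤ) (v : Piling G) : (shift c v).height = v.height + c := by
  have : ∀ L : List (Fin m), (((L.map fun j => gen j ^ c j).prod : Equiv.Perm _) v).height =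
      v.height + (L.map fun j => Pi.single j (c j)).sum := by
    intro L
    induction L with
    | nil => simp
    | cons j L ih =>
      rw [List.map_cons, List.prod_cons, Equiv.Perm.mul_apply, height_gen_zpow, ih]
      simp only [List.map_cons, List.sum_cons]
      abel
  rw [shift, this, ← List.ofFn_eq_map, List.sum_ofFn, Finset.univ_sum_single]

theorem length_shift_le (c : Fin m → ℤ) (v : Piling G) :
    (shift c v).length ≤ v.length + ∑ i, (c i).natAbs := by
  have : ∀ L : List (Fin m), (((L.map fun j => gen j ^ c j).prod : Equiv.Perm _) v).length ≤
      v.length + (L.map fun j => (c j).natAbs).sum := by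
    intro L
    induction L with
    | nil => simp
    | cons j L ih =>
      rw [List.map_cons, List.prod_cons, Equiv.Perm.mul_apply, List.map_cons, List.sum_cons]
      have := length_gen_zpow_le j (c j) (((L.map fun j => gen j ^ c j).prod : Equiv.Perm _) v)
      omega
  refine (this _).trans ?_
  rw [← List.ofFn_eq_map, List.sum_ofFn]

/-- A set of pilings that is closed under removing non-zero top letters. -/
def DownClosed (S : Set (Piling G)) : Prop :=
  ∀ v ∈ S, ∀ i, v.top i ≠ 0 → act i (-v.top i) v ∈ S

theorem DownClosed.shift_mem {S : Set (Piling G)} (hS : DownClosed S) {v : Piling G} (hv : v ∈ S)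
    {c : Fin m → ℤ} (hc : ∀ i, c i = 0 ∨ c i = -(v.top i : ℤ)) : shift c v ∈ S := by
  have : ∀ L : List (Fin m), L.Nodup →
      ((L.map fun j => gen j ^ c j).prod : Equiv.Perm _) v ∈ S ∧ ∀ j ∉ L, v.top j ≠ 0 →
        (((L.map fun j => gen j ^ c j).prod : Equiv.Perm _) v).top j = v.top j := by
    intro L hL
    induction L with
    | nil => simpa using hv
    | cons i L ih =>
      obtain ⟨hi, hL⟩ := List.nodup_cons.1 hL
      obtain ⟨h1, h2⟩ := ih hL
      rw [List.map_cons, List.prod_cons, Equiv.Perm.mul_apply]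
      set w := ((L.map fun j => gen j ^ c j).prod : Equiv.Perm _) v with hw
      by_cases hci : c i = 0
      · rw [hci]
        refine ⟨by simpa using h1, fun j hj hj0 => ?_⟩
        simpa using h2 j (fun h => hj (List.mem_cons_of_mem _ h)) hj0
      · have hc' : c i = ((-v.top i : SignType) : ℤ) := by
          rw [(hc i).resolve_left hci]
          cases v.top i <;> rfl
        have hvi : v.top i ≠ 0 := by
          intro h
          apply hci
          rw [hc', h]
          rfl
        rw [hc', gen_zpow_signType, ← h2 i hi hvi]
        refine ⟨hS w h1 i (by rwa [h2 i hi hvi]), fun j hj hj0 => ?_⟩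
        rw [List.mem_cons, not_or] at hj
        rw [top_act_of_adj (v.adj_of_top_ne_zero hvi hj0 (Ne.symm hj.1))]
        exact h2 j hj.2 hj0
  exact (this _ (List.nodup_finRange m)).1

end Fin

end Piling

/-- The graph formed by the vertices and edges of a simplicial complex. -/
def faceGraph {m : ℕ} (K : Finset (Finset (Fin m))) : SimpleGraph (Fin m) where
  Adj i j := i ≠ j ∧ ({i, j} : Finset (Fin m)) ∈ K
  symm.symm i j h := ⟨h.1.symm, by rw [Finset.pair_comm]; exact h.2⟩
  loopless.irrefl i h := h.1 rfl

instance {ι : Type*} (G : SimpleGraph ι) : TopologicalSpace (Piling G) := ⊥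

instance {ι : Type*} (G : SimpleGraph ι) : DiscreteTopology (Piling G) := ⟨rfl⟩

/-- The points of `L_K` at sup-distance less than one from the lattice point `a`. -/
def latticeStar {m : ℕ} (K : Finset (Finset (Fin m))) (a : Fin m → ℤ) :
    Set (realPolyhedralProduct m K) :=
  {y | ∀ i, |y.1 i - a i| < 1}

theorem isOpen_latticeStar {m : ℕ} (K : Finset (Finset (Fin m))) (a : Fin m → ℤ) :
    IsOpen (latticeStar K a) := by
  simp only [latticeStar, Set.ofPred_forall]
  refine isOpen_iInter_of_finite fun i => isOpen_lt ?_ continuous_const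
  exact (((continuous_apply i).comp continuous_subtype_val).sub continuous_const).abs

theorem floor_mem_latticeStar {m : ℕ} {K : Finset (Finset (Fin m))}
    (y : realPolyhedralProduct m K) : y ∈ latticeStar K fun i => ⌊y.1 i⌋ := by
  intro i
  rw [abs_lt]
  constructor <;> linarith [Int.floor_le (y.1 i), Int.lt_floor_add_one (y.1 i)]

theorem adj_of_mem_latticeStar {m : ℕ} {K : Finset (Finset (Fin m))}
    (hdown : ∀ I ∈ K, ∀ J ⊆ I, J ∈ K) {y : realPolyhedralProduct m K} {a b c d : Fin m → ℤ}
    (ha : y ∈ latticeStar K a) (hb : y ∈ latticeStar K b) (hc : y ∈ latticeStar K c)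
    (hd : y ∈ latticeStar K d) {i j : Fin m} (hi : (b - a) i ≠ 0) (hj : (d - c) j ≠ 0)
    (hij : i ≠ j) : (faceGraph K).Adj i j := by
  obtain ⟨I, hI, hy⟩ := y.2
  have key : ∀ {a b : Fin m → ℤ} {i : Fin m}, y ∈ latticeStar K a → y ∈ latticeStar K b →
      (b - a) i ≠ 0 → i ∈ I := by
    intro a b i ha hb hi
    by_contra h
    obtain ⟨n, hn⟩ := hy i h
    have : ∀ {a : Fin m → ℤ}, y ∈ latticeStar K a → a i = n := by
      intro a ha
      have h1 := ha i
      rw [hn] at h1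
      have h2 : |n - a i| < 1 := by exact_mod_cast h1
      rw [Int.abs_lt_one_iff] at h2
      omega
    exact hi (by rw [Pi.sub_apply, this ha, this hb, sub_self])
  refine ⟨hij, hdown I hI _ ?_⟩
  intro k hk
  rcases Finset.mem_insert.1 hk with rfl | hk
  · exact key ha hb hi
  · rw [Finset.mem_singleton.1 hk]
    exact key hc hd hj

/-- The covering space of `L_K` whose fibre is the set of pilings, as a fibre bundle that is
trivial over the stars of lattice points. -/
noncomputable def pilingBundle {m : ℕ} {K : Finset (Finset (Fin m))}
    (hdown : ∀ I ∈ K, ∀ J ⊆ I, J ∈ K) :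
    FiberBundleCore (Fin m → ℤ) (realPolyhedralProduct m K) (Piling (faceGraph K)) where
  baseSet := latticeStar K
  isOpen_baseSet := isOpen_latticeStar K
  indexAt y i := ⌊y.1 i⌋
  mem_baseSet_at := floor_mem_latticeStar
  coordChange a b _ := Piling.shift (b - a)
  coordChange_self a _ _ v := by rw [sub_self, Piling.shift_zero, Equiv.Perm.one_apply]
  continuousOn_coordChange a b :=
    ((continuous_of_discreteTopology (f := Piling.shift (b - a))).comp
      continuous_snd).continuousOn
  coordChange_comp a b c y hy v := by
    rw [← Equiv.Perm.mul_apply, ← Piling.shift_add, sub_add_sub_cancel]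
    intro i j
    exact adj_of_mem_latticeStar hdown hy.1.2 hy.2 hy.1.1 hy.1.2

/-- The total space of `pilingBundle`. -/
abbrev PilingCover {m : ℕ} {K : Finset (Finset (Fin m))}
    (hdown : ∀ I ∈ K, ∀ J ⊆ I, J ∈ K) : Type :=
  Bundle.TotalSpace (Piling (faceGraph K)) (pilingBundle hdown).Fiber

namespace PilingCover

variable {m : ℕ} {K : Finset (Finset (Fin m))} {hdown : ∀ I ∈ K, ∀ J ⊆ I, J ∈ K}

/-- The projection of the covering space. -/
def proj (e : PilingCover hdown) : realPolyhedralProduct m K := e.1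

/-- The fibre coordinate in the trivialisation over the star of the lattice point `a`. -/
noncomputable def chart (a : Fin m → ℤ) (e : PilingCover hdown) : Piling (faceGraph K) :=
  ((pilingBundle hdown).localTriv a e).2

theorem isCoveringMap_proj : IsCoveringMap (proj : PilingCover hdown → _) :=
  FiberBundle.isCoveringMap (F := Piling (faceGraph K)) (E := (pilingBundle hdown).Fiber)

theorem chart_eq_shift {a b : Fin m → ℤ} {e : PilingCover hdown} (ha : e.proj ∈ latticeStar K a)
    (hb : e.proj ∈ latticeStar K b) : e.chart b = Piling.shift (b - a) (e.chart a) :=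
  ((pilingBundle hdown).coordChange_comp ((pilingBundle hdown).indexAt e.1) a b e.1
    ⟨⟨(pilingBundle hdown).mem_baseSet_at e.1, ha⟩, hb⟩ e.2).symm

theorem isOpen_chart (a : Fin m → ℤ) (v : Piling (faceGraph K)) :
    IsOpen {e : PilingCover hdown | e.proj ∈ latticeStar K a ∧ e.chart a = v} := by
  have h := ((pilingBundle hdown).localTriv a).toOpenPartialHomeomorph.isOpen_inter_preimage
    (isOpen_univ.prod (isOpen_discrete {v}))
  convert h using 1
  ext e
  refine and_congr Iff.rfl ?_
  simp only [Set.mem_preimage, Set.mem_prod, Set.mem_univ, true_and, Set.mem_singleton_iff]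
  rfl

theorem exists_proj_chart {a : Fin m → ℤ} {y : realPolyhedralProduct m K}
    (hy : y ∈ latticeStar K a) (v : Piling (faceGraph K)) :
    ∃ e : PilingCover hdown, e.proj = y ∧ e.chart a = v := by
  refine ⟨⟨y, (pilingBundle hdown).coordChange a ((pilingBundle hdown).indexAt y) y v⟩, rfl, ?_⟩
  refine ((pilingBundle hdown).coordChange_comp a ((pilingBundle hdown).indexAt y) a y
    ⟨⟨hy, (pilingBundle hdown).mem_baseSet_at y⟩, hy⟩ v).trans ?_
  exact (pilingBundle hdown).coordChange_self a y hy v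

theorem eq_of_chart_eq {a : Fin m → ℤ} {e e' : PilingCover hdown}
    (ha : e.proj ∈ latticeStar K a) (h : e.proj = e'.proj) (hc : e.chart a = e'.chart a) :
    e = e' := by
  have ha' : e'.proj ∈ latticeStar K a := h ▸ ha
  refine ((pilingBundle hdown).localTriv a).toOpenPartialHomeomorph.injOn ha ha' ?_
  exact Prod.ext h hc

theorem continuousAt_of_chart {Q : Type*} [TopologicalSpace Q] {g : Q → PilingCover hdown} {q : Q}
    {a : Fin m → ℤ} (ha : (g q).proj ∈ latticeStar K a)
    (hp : ContinuousAt (fun q => (g q).proj) q)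
    (hc : ∀ᶠ q' in nhds q, (g q').chart a = (g q).chart a) : ContinuousAt g q := by
  have hU : ∀ᶠ q' in nhds q, (g q').proj ∈ latticeStar K a :=
    hp.eventually ((isOpen_latticeStar K a).mem_nhds ha)
  refine (((pilingBundle hdown).localTriv a).toOpenPartialHomeomorph
    |>.continuousAt_iff_continuousAt_comp_left ?_).2 ?_
  · exact hU
  · refine ContinuousAt.prodMk hp ?_
    exact (continuousAt_const (y := (g q).chart a)).congr (hc.mono fun _ h => h.symm)

instance : T2Space (PilingCover hdown) where
  t2 e e' h := by
    by_cases hp : e.proj = e'.proj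
    · exact isCoveringMap_proj.isSeparatedMap e e' hp h
    · obtain ⟨u, v, hu, hv, h1, h2, h3⟩ := t2_separation hp
      exact ⟨_, _, hu.preimage isCoveringMap_proj.continuous,
        hv.preimage isCoveringMap_proj.continuous, h1, h2, h3.preimage _⟩

/-- The open star of the vertex of the covering space given by a piling. -/
def star (hdown : ∀ I ∈ K, ∀ J ⊆ I, J ∈ K) (v : Piling (faceGraph K)) :
    Set (PilingCover hdown) :=
  {e | e.proj ∈ latticeStar K v.height ∧ e.chart v.height = v}

theorem isOpen_star (v : Piling (faceGraph K)) : IsOpen (star hdown v) := isOpen_chart _ v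

theorem eq_shift_of_mem_star {v w : Piling (faceGraph K)} {e : PilingCover hdown}
    (hv : e ∈ star hdown v) (hw : e ∈ star hdown w) :
    w = Piling.shift (w.height - v.height) v := by
  have := chart_eq_shift hv.1 hw.1
  rwa [hv.2, hw.2] at this

theorem mem_star_of_height_eq {a : Fin m → ℤ} {e : PilingCover hdown}
    (ha : e.proj ∈ latticeStar K a) (h : (e.chart a).height = a) :
    e ∈ star hdown (e.chart a) := by
  rw [star, Set.mem_ofPred_eq, h]
  exact ⟨ha, rfl⟩

theorem height_chart_of_mem_star {a : Fin m → ℤ} {v : Piling (faceGraph K)}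
    {e : PilingCover hdown} (hv : e ∈ star hdown v) (ha : e.proj ∈ latticeStar K a) :
    (e.chart a).height = a := by
  rw [chart_eq_shift hv.1 ha, hv.2, Piling.height_shift, add_sub_cancel]

/-- The component of the covering space formed by the stars of the pilings. -/
def mainComponent (hdown : ∀ I ∈ K, ∀ J ⊆ I, J ∈ K) : Set (PilingCover hdown) :=
  ⋃ v, star hdown v

theorem isOpen_mainComponent : IsOpen (mainComponent hdown) := isOpen_iUnion isOpen_star

theorem isClosed_mainComponent : IsClosed (mainComponent hdown) := by
  have : (mainComponent hdown)ᶜ = ⋃ p : {p : (Fin m → ℤ) × Piling (faceGraph K) //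
      p.2.height ≠ p.1}, {e | e.proj ∈ latticeStar K p.1.1 ∧ e.chart p.1.1 = p.1.2} := by
    ext e
    simp only [Set.mem_compl_iff, Set.mem_iUnion, mainComponent]
    constructor
    · intro h
      have h2 : (e.chart fun i => ⌊e.proj.1 i⌋).height ≠ fun i => ⌊e.proj.1 i⌋ := fun h' =>
        h ⟨_, mem_star_of_height_eq (floor_mem_latticeStar e.proj) h'⟩
      exact ⟨⟨⟨_, _⟩, h2⟩, floor_mem_latticeStar e.proj, rfl⟩
    · rintro ⟨⟨⟨a, v⟩, h⟩, ha, hv⟩ ⟨w, hw⟩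
      apply h
      rw [← hv]
      exact height_chart_of_mem_star hw ha
  rw [← isOpen_compl_iff, this]
  exact isOpen_iUnion fun p => isOpen_chart _ _

theorem exists_mem_mainComponent (y : realPolyhedralProduct m K) :
    ∃ e ∈ mainComponent hdown, e.proj = y := by
  let o : Piling (faceGraph K) := ⟨_, IsPiling.empty⟩
  have ho : o.height = 0 := rfl
  obtain ⟨e, he, hc⟩ := exists_proj_chart (hdown := hdown) (floor_mem_latticeStar y)
    (Piling.shift (fun i => ⌊y.1 i⌋) o)
  subst he
  refine ⟨e, Set.mem_iUnion.2 ⟨_, mem_star_of_height_eq (floor_mem_latticeStar e.proj) ?_⟩, rfl⟩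
  rw [hc, Piling.height_shift, ho, zero_add]

/-- The union of all closed cells with vertices in `S`. -/
def subcomplex (hdown : ∀ I ∈ K, ∀ J ⊆ I, J ∈ K) (S : Set (Piling (faceGraph K))) :
    Set (PilingCover hdown) :=
  {e | e ∈ mainComponent hdown ∧ ∀ v, e ∈ star hdown v → v ∈ S}

theorem isClosed_subcomplex (S : Set (Piling (faceGraph K))) :
    IsClosed (subcomplex hdown S) := by
  have : subcomplex hdown S = mainComponent hdown ∩ ⋂ v ∈ Sᶜ, (star hdown v)ᶜ := by
    ext e
    simp only [subcomplex, Set.mem_ofPred_eq, Set.mem_inter_iff, Set.mem_iInter, Set.mem_compl_iff]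
    exact and_congr_right fun _ => forall_congr' fun v => not_imp_not.symm
  rw [this]
  exact isClosed_mainComponent.inter
    (isClosed_biInter fun v _ => (isOpen_star v).isClosed_compl)

theorem exists_subset_subcomplex {C : Set (PilingCover hdown)} (hC : IsCompact C)
    (h : C ⊆ mainComponent hdown) : ∃ k, C ⊆ subcomplex hdown {v | v.length ≤ k} := by
  obtain ⟨T, hT⟩ := hC.elim_finite_subcover _ (isOpen_star (hdown := hdown)) h
  refine ⟨T.sup Piling.length + m, fun e he => ⟨h he, fun w hw => ?_⟩⟩
  obtain ⟨v, hv⟩ := Set.mem_iUnion.1 (hT he)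
  obtain ⟨hvT, hv⟩ := Set.mem_iUnion.1 hv
  have h1 := eq_shift_of_mem_star hv hw
  have h2 : ∀ i, ((w.height - v.height) i).natAbs ≤ 1 := by
    intro i
    have h3 := abs_lt.1 (hv.1 i)
    have h4 := abs_lt.1 (hw.1 i)
    have h5 : w.height i - v.height i < 2 := by
      have : (w.height i - v.height i : ℝ) < 2 := by linarith [h3.1, h3.2, h4.1, h4.2]
      exact_mod_cast this
    have h6 : -2 < w.height i - v.height i := by
      have : (-2 : ℝ) < (w.height i - v.height i : ℝ) := by linarith [h3.1, h3.2, h4.1, h4.2]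
      exact_mod_cast this
    rw [Pi.sub_apply]
    omega
  change w.length ≤ _
  rw [h1]
  refine (Piling.length_shift_le _ _).trans (add_le_add (Finset.le_sup hvT) ?_)
  refine (Finset.sum_le_sum fun i _ => h2 i).trans ?_
  simp

end PilingCover

/-- A subset of a topological space is an absolute extensor for metric spaces. -/
def IsAbsoluteExtensor {E : Type*} [TopologicalSpace E] (S : Set E) : Prop :=
  ∀ (Q : Type) [MetricSpace Q] (A : Set Q), IsClosed A → ∀ f : Q → E, ContinuousOn f A →
    Set.MapsTo f A S → ∃ g : Q → E, Continuous g ∧ (∀ q, g q ∈ S) ∧ Set.EqOn g f A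

open Classical in
theorem IsAbsoluteExtensor.union {E : Type*} [TopologicalSpace E] {S T : Set E}
    (hS : IsAbsoluteExtensor S) (hT : IsAbsoluteExtensor T) (hST : IsAbsoluteExtensor (S ∩ T))
    (hSc : IsClosed S) (hTc : IsClosed T) : IsAbsoluteExtensor (S ∪ T) := by
  intro Q _ A hA f hf hfA
  have h1 : IsClosed (A ∩ f ⁻¹' S) := hf.preimage_isClosed_of_isClosed hA hSc
  have h2 : IsClosed (A ∩ f ⁻¹' T) := hf.preimage_isClosed_of_isClosed hA hTc
  set A₁ := A ∩ f ⁻¹' S with hA₁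
  set A₂ := A ∩ f ⁻¹' T with hA₂
  let Q₀ : Set Q := {q | Metric.infEDist q A₁ = Metric.infEDist q A₂}
  have hQ₀ : IsClosed Q₀ := isClosed_eq Metric.continuous_infEDist Metric.continuous_infEDist
  have hmem : ∀ {B : Set Q}, IsClosed B → ∀ {q}, q ∈ B ↔ Metric.infEDist q B = 0 := by
    intro B hB q
    rw [← Metric.mem_closure_iff_infEDist_zero, hB.closure_eq]
  have h12 : ∀ q ∈ Q₀, q ∈ A₁ ↔ q ∈ A₂ := by
    intro q hq
    rw [hmem h1, hmem h2, show Metric.infEDist q A₁ = Metric.infEDist q A₂ from hq]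
  have hA12 : ∀ q ∈ A, q ∈ A₁ ∨ q ∈ A₂ := by
    intro q hq
    exact (hfA hq).imp (fun h => ⟨hq, h⟩) fun h => ⟨hq, h⟩
  obtain ⟨g₀, hg₀, hg₀S, hg₀f⟩ := hST Q (A ∩ Q₀) (hA.inter hQ₀) f
    (hf.mono Set.inter_subset_left) (by
      rintro q ⟨hq, hq0⟩
      rcases hA12 q hq with h | h
      · exact ⟨h.2, ((h12 q hq0).1 h).2⟩
      · exact ⟨((h12 q hq0).2 h).2, h.2⟩)
  have key : ∀ {B : Set Q} {R : Set E}, IsAbsoluteExtensor R → IsClosed B → B ⊆ A →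
      Set.MapsTo f B R → (∀ q, g₀ q ∈ R) →
      ∃ g : Q → E, Continuous g ∧ (∀ q, g q ∈ R) ∧ Set.EqOn g f B ∧ Set.EqOn g g₀ Q₀ := by
    intro B R hR hB hBA hBR hgR
    let φ : Q → E := fun q => if q ∈ B then f q else g₀ q
    have hφ₁ : Set.EqOn φ f B := fun q hq => if_pos hq
    have hφ₂ : Set.EqOn φ g₀ Q₀ := by
      intro q hq
      by_cases hqB : q ∈ B
      · exact (if_pos hqB).trans (hg₀f ⟨hBA hqB, hq⟩).symm
      · exact if_neg hqB
    obtain ⟨g, hg, hgR', hgφ⟩ := hR Q (B ∪ Q₀) (hB.union hQ₀) φ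
      (((hf.mono hBA).congr hφ₁).union_of_isClosed (hg₀.continuousOn.congr hφ₂) hB hQ₀) (by
        intro q _
        by_cases hqB : q ∈ B
        · rw [hφ₁ hqB]
          exact hBR hqB
        · rw [show φ q = g₀ q from if_neg hqB]
          exact hgR q)
    exact ⟨g, hg, hgR', fun q hq => (hgφ (Or.inl hq)).trans (hφ₁ hq),
      fun q hq => (hgφ (Or.inr hq)).trans (hφ₂ hq)⟩
  obtain ⟨g₁, hg₁, hg₁S, hg₁f, hg₁g⟩ := key hS h1 Set.inter_subset_left
    (fun q hq => hq.2) fun q => (hg₀S q).1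
  obtain ⟨g₂, hg₂, hg₂T, hg₂f, hg₂g⟩ := key hT h2 Set.inter_subset_left
    (fun q hq => hq.2) fun q => (hg₀S q).2
  refine ⟨fun q => if Metric.infEDist q A₁ ≤ Metric.infEDist q A₂ then g₁ q else g₂ q,
    hg₁.if_le hg₂ Metric.continuous_infEDist Metric.continuous_infEDist
      fun q hq => (hg₁g hq).trans (hg₂g hq).symm, fun q => ?_, fun q hq => ?_⟩
  · dsimp only
    split_ifs
    · exact Or.inl (hg₁S q)
    · exact Or.inr (hg₂T q)
  · dsimp only
    split_ifs with h
    · refine hg₁f ?_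
      rcases hA12 q hq with hqA | hqA
      · exact hqA
      · rw [(hmem h2).1 hqA] at h
        exact (hmem h1).2 (nonpos_iff_eq_zero.1 h)
    · refine hg₂f ?_
      rcases hA12 q hq with hqA | hqA
      · rw [(hmem h1).1 hqA] at h
        exact absurd zero_le h
      · exact hqA

/-- The image of a retract of a cube under a map with a continuous left inverse is an absolute
extensor. -/
theorem isAbsoluteExtensor_of_cube {E ι : Type*} [TopologicalSpace E] {S : Set E}
    (φ : (ι → unitInterval) → E) (hφ : Continuous φ) (hφS : ∀ t, φ t ∈ S)
    (r : E → ι → unitInterval) (hr : Continuous r) (hφr : ∀ e ∈ S, φ (r e) = e) :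
    IsAbsoluteExtensor S := by
  intro Q _ A hA f hf hfA
  obtain ⟨g, hg⟩ := ContinuousMap.exists_restrict_eq hA
    (⟨A.domRestrict fun q => r (f q), continuousOn_iff_continuous_domRestrict.1
      (hr.comp_continuousOn hf)⟩ : C(A, ι → unitInterval))
  refine ⟨fun q => φ (g q), hφ.comp g.continuous, fun q => hφS _, fun q hq => ?_⟩
  have : g q = r (f q) := DFunLike.congr_fun hg ⟨q, hq⟩
  dsimp only
  rw [this, hφr _ (hfA hq)]

namespace PilingCover

variable {m : ℕ} {K : Finset (Finset (Fin m))} {hdown : ∀ I ∈ K, ∀ J ⊆ I, J ∈ K}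

theorem exists_cellPoint (hflag : ∀ J : Finset (Fin m),
      (∀ i ∈ J, ∀ j ∈ J, i ≠ j → ({i, j} : Finset (Fin m)) ∈ K) → J ∈ K)
    (v : Piling (faceGraph K)) (t : Fin m → unitInterval) :
    ∃ I ∈ K, ∀ k, k ∉ I → ∃ n : ℤ, (v.height k - (v.top k : ℤ) * t k : ℝ) = n := by
  classical
  refine ⟨Finset.univ.filter fun i => v.top i ≠ 0, hflag _ ?_, fun k hk => ⟨v.height k, ?_⟩⟩
  · intro i hi j hj hij
    rw [Finset.mem_filter] at hi hj
    exact (v.adj_of_top_ne_zero hi.2 hj.2 hij).2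
  · have : v.top k = 0 := by simpa using hk
    rw [this]
    simp

/-- If the point with coordinates `t` in the cell below `v` lies in the star of `b`, then `b` is a
vertex of this cell. -/
theorem sub_height_eq_zero_or {v : Piling (faceGraph K)} {t : ℝ} (ht : t ∈ unitInterval)
    {b : ℤ} {i : Fin m} (h : |(v.height i - (v.top i : ℤ) * t : ℝ) - b| < 1) :
    b - v.height i = 0 ∨ b - v.height i = -(v.top i : ℤ) := by
  rw [abs_lt] at h
  obtain ⟨h0, h1⟩ := ht
  generalize v.height i = a at *
  have key : ∀ {d : ℤ}, (d = 0 ∨ d = 1 ∨ d = -1) → -1 < (a - d * t : ℝ) - b ∧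
      (a - d * t : ℝ) - b < 1 → b - a = 0 ∨ b - a = -d := by
    rintro d (rfl | rfl | rfl) ⟨h2, h3⟩
    · have h4 : b - a < 1 := by
        have : (b - a : ℝ) < 1 := by simp at h2; linarith
        exact_mod_cast this
      have h5 : -1 < b - a := by
        have : (-1 : ℝ) < (b - a : ℝ) := by simp at h3; linarith
        exact_mod_cast this
      omega
    · have h4 : b - a < 1 := by
        have : (b - a : ℝ) < 1 := by simp at h2; linarith
        exact_mod_cast this
      have h5 : -2 < b - a := by
        have : (-2 : ℝ) < (b - a : ℝ) := by simp at h3; linarith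
        exact_mod_cast this
      omega
    · have h4 : b - a < 2 := by
        have : (b - a : ℝ) < 2 := by simp at h2; linarith
        exact_mod_cast this
      have h5 : -1 < b - a := by
        have : (-1 : ℝ) < (b - a : ℝ) := by simp at h3; linarith
        exact_mod_cast this
      omega
  refine key ?_ h
  cases v.top i <;> simp

theorem exists_cell (hflag : ∀ J : Finset (Fin m),
      (∀ i ∈ J, ∀ j ∈ J, i ≠ j → ({i, j} : Finset (Fin m)) ∈ K) → J ∈ K)
    (v : Piling (faceGraph K)) :
    ∃ φ : (Fin m → unitInterval) → PilingCover hdown, Continuous φ ∧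
      (∀ t i, (φ t).proj.1 i = v.height i - (v.top i : ℤ) * t i) ∧
      ∀ t b, (φ t).proj ∈ latticeStar K b → (φ t).chart b = Piling.shift (b - v.height) v := by
  let y : (Fin m → unitInterval) → realPolyhedralProduct m K := fun t =>
    ⟨fun i => v.height i - (v.top i : ℤ) * t i, exists_cellPoint hflag v t⟩
  have hy : Continuous y := by
    refine Continuous.subtype_mk (continuous_pi fun i => ?_) _
    fun_prop
  choose φ hφ hφc using fun t => exists_proj_chart (hdown := hdown) (floor_mem_latticeStar (y t))
    (Piling.shift ((fun i => ⌊(y t).1 i⌋) - v.height) v)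
  have htop : ∀ {t a i}, y t ∈ latticeStar K a → (a - v.height) i ≠ 0 → v.top i ≠ 0 := by
    intro t a i ha hi h
    rcases sub_height_eq_zero_or (t i).2 (ha i) with h1 | h1
    · exact hi h1
    · rw [h] at h1
      exact hi h1
  have hchart : ∀ t b, (φ t).proj ∈ latticeStar K b →
      (φ t).chart b = Piling.shift (b - v.height) v := by
    intro t b hb
    have hfl : (φ t).proj ∈ latticeStar K fun i => ⌊(y t).1 i⌋ := by
      rw [hφ]
      exact floor_mem_latticeStar (y t)
    rw [chart_eq_shift hfl hb, hφc, ← Equiv.Perm.mul_apply, ← Piling.shift_add,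
      sub_add_sub_cancel]
    rw [hφ] at hfl hb
    intro i j hi hj hij
    refine v.adj_of_top_ne_zero ?_ (htop hfl hj) hij
    by_contra h
    have h1 : (b - v.height) i = 0 := by
      by_contra h'
      exact htop hb h' h
    have h2 : ((fun i => ⌊(y t).1 i⌋) - v.height) i = 0 := by
      by_contra h'
      exact htop hfl h' h
    apply hi
    simp only [Pi.sub_apply] at h1 h2 ⊢
    omega
  refine ⟨φ, continuous_iff_continuousAt.2 fun t => ?_, fun t i => by rw [hφ], hchart⟩
  have hp : Continuous fun t => (φ t).proj := by
    simpa only [hφ] using hy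
  have ht := floor_mem_latticeStar (φ t).proj
  refine continuousAt_of_chart ht hp.continuousAt ?_
  filter_upwards [hp.continuousAt.eventually ((isOpen_latticeStar K _).mem_nhds ht)] with s hs
  rw [hchart _ _ ht, hchart _ _ hs]

/-- A retraction of a cube onto the union of the faces `t i = 1` for `i ∈ D`. -/
theorem exists_cube_retraction {D : Finset (Fin m)} (hD : D.Nonempty) :
    ∃ ρ : (Fin m → unitInterval) → Fin m → unitInterval, Continuous ρ ∧
      (∀ t, ∃ i ∈ D, ρ t i = 1) ∧ ∀ t, (∃ i ∈ D, t i = 1) → ρ t = t := by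
  have hM : Continuous fun t : Fin m → unitInterval => D.sup t :=
    Continuous.finset_sup_apply fun i _ => continuous_apply i
  refine ⟨fun t i => Set.projIcc 0 1 zero_le_one (t i + (1 - (D.sup t : unitInterval))),
    continuous_pi fun i => continuous_projIcc.comp (((continuous_subtype_val.comp
      (continuous_apply i))).add (continuous_const.sub (continuous_subtype_val.comp hM))),
    fun t => ?_, fun t ht => ?_⟩
  · obtain ⟨i, hi, h⟩ := Finset.exists_mem_eq_sup D hD t
    refine ⟨i, hi, ?_⟩
    dsimp only
    rw [h, add_sub_cancel, Set.projIcc_right]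
    rfl
  · obtain ⟨i, hi, h⟩ := ht
    have h1 : D.sup t = 1 := le_antisymm unitInterval.le_one' (h ▸ Finset.le_sup hi)
    funext j
    dsimp only
    rw [h1]
    simp

theorem isAbsoluteExtensor_subcomplex (hflag : ∀ J : Finset (Fin m),
      (∀ i ∈ J, ∀ j ∈ J, i ≠ j → ({i, j} : Finset (Fin m)) ∈ K) → J ∈ K)
    (S : Finset (Piling (faceGraph K))) (hS : Piling.DownClosed (S : Set (Piling (faceGraph K))))
    (hne : S.Nonempty) :
    IsAbsoluteExtensor (subcomplex hdown (S : Set (Piling (faceGraph K)))) := by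
  classical
  induction S using Finset.strongInduction with
  | H S ih =>
  obtain ⟨v, hv, hmax⟩ := S.exists_max_image Piling.length hne
  obtain ⟨φ, hφ, hφp, hφc⟩ := exists_cell (hdown := hdown) hflag v
  let r : PilingCover hdown → Fin m → unitInterval := fun e i =>
    Set.projIcc 0 1 zero_le_one ((v.height i - e.proj.1 i) * (v.top i : ℤ))
  have hr : Continuous r := by
    refine continuous_pi fun i => continuous_projIcc.comp ?_
    have : Continuous fun e : PilingCover hdown => e.proj.1 i :=
      (continuous_apply i).comp (continuous_subtype_val.comp isCoveringMap_proj.continuous)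
    exact (continuous_const.sub this).mul continuous_const
  have hrφ : ∀ t i, v.top i ≠ 0 → r (φ t) i = t i := by
    intro t i hi
    have h1 : (v.height i - (φ t).proj.1 i : ℝ) * (v.top i : ℤ) = t i := by
      rw [hφp]
      revert hi
      cases v.top i <;> simp
    simp only [r, h1, Set.projIcc_val]
  have hφr : ∀ e ∈ Set.range φ, φ (r e) = e := by
    rintro _ ⟨t, rfl⟩
    have hp : (φ (r (φ t))).proj = (φ t).proj := by
      refine Subtype.ext (funext fun i => ?_)
      rw [hφp, hφp]
      by_cases hi : v.top i = 0
      · rw [hi]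
        simp
      · rw [hrφ t i hi]
    have h1 := floor_mem_latticeStar (φ t).proj
    refine (eq_of_chart_eq h1 hp.symm ?_).symm
    rw [hφc _ _ h1, hφc _ _ (hp ▸ h1)]
  have hφS : ∀ t, φ t ∈ subcomplex hdown (S : Set (Piling (faceGraph K))) := by
    intro t
    refine ⟨Set.mem_iUnion.2 ⟨_, mem_star_of_height_eq (floor_mem_latticeStar (φ t).proj) ?_⟩,
      fun w hw => ?_⟩
    · rw [hφc _ _ (floor_mem_latticeStar (φ t).proj), Piling.height_shift, add_sub_cancel]
    · rw [← hw.2, hφc _ _ hw.1]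
      refine hS.shift_mem hv fun i => sub_height_eq_zero_or (t i).2 ?_
      rw [← hφp]
      exact hw.1 i
  have hcell : IsAbsoluteExtensor (Set.range φ) :=
    isAbsoluteExtensor_of_cube φ hφ (fun t => ⟨t, rfl⟩) r hr hφr
  have hstar : ∀ e ∈ subcomplex hdown (S : Set (Piling (faceGraph K))), e ∈ star hdown v →
      e ∈ Set.range φ := by
    intro e he hev
    have hp : (φ (r e)).proj = e.proj := by
      refine Subtype.ext (funext fun i => ?_)
      rw [hφp]
      have h1 := abs_lt.1 (hev.1 i)
      have hact : ∀ s : SignType, s ≠ 0 → 0 < (e.proj.1 i - v.height i) * (s : ℤ) →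
          v.top i = -s := by
        intro s hs hpos
        have h2 := Piling.act_cases i hs v
        have hw : e ∈ star hdown (Piling.act i s v) := by
          have h3 : e.proj ∈ latticeStar K (Piling.act i s v).height := by
            intro j
            rw [h2.2, Pi.add_apply]
            by_cases hj : j = i
            · subst hj
              rw [Pi.single_eq_same, abs_lt]
              revert hs hpos
              cases s <;> simp <;> intro hpos <;> constructor <;> linarith
            · rw [Pi.single_eq_of_ne hj, add_zero]
              exact hev.1 j
          refine ⟨h3, ?_⟩
          rw [chart_eq_shift hev.1 h3, hev.2, h2.2, add_sub_cancel_left, Piling.shift_single]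
        have h4 := hmax _ (he.2 _ hw)
        rcases h2.1 with h5 | h5
        · exact h5.1
        · omega
      simp only [r]
      rcases lt_trichotomy (e.proj.1 i - v.height i : ℝ) 0 with h | h | h
      · have h3 := hact (-1) (by decide) (by simpa using h)
        rw [h3, neg_neg]
        rw [Set.projIcc_of_mem _ (show _ ∈ Set.Icc (0 : ℝ) 1 by
          constructor <;> simp <;> linarith)]
        simp
      · rw [show (v.height i - e.proj.1 i : ℝ) = 0 by linarith, zero_mul]
        simp
        linarith
      · have h3 := hact 1 (by decide) (by simpa using h)
        rw [h3]
        rw [Set.projIcc_of_mem _ (show _ ∈ Set.Icc (0 : ℝ) 1 by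
          constructor <;> simp <;> linarith)]
        simp
    refine ⟨r e, (eq_of_chart_eq hev.1 hp.symm ?_).symm⟩
    rw [hφc _ _ (hp ▸ hev.1), sub_self, Piling.shift_zero, hev.2]
    rfl
  have hunion : subcomplex hdown (S : Set (Piling (faceGraph K))) =
      subcomplex hdown (S.erase v : Set (Piling (faceGraph K))) ∪ Set.range φ := by
    ext e
    constructor
    · intro he
      by_cases hev : e ∈ star hdown v
      · exact Or.inr (hstar e he hev)
      · refine Or.inl ⟨he.1, fun w hw => ?_⟩
        rw [Finset.mem_coe, Finset.mem_erase]
        exact ⟨fun h => hev (h ▸ hw), he.2 w hw⟩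
    · rintro (he | ⟨t, rfl⟩)
      · exact ⟨he.1, fun w hw => Finset.mem_of_mem_erase (he.2 w hw)⟩
      · exact hφS t
  rcases (S.erase v).eq_empty_or_nonempty with hempty | hne'
  · have h0 : subcomplex hdown (S.erase v : Set (Piling (faceGraph K))) = ∅ := by
      rw [hempty]
      refine Set.eq_empty_of_forall_notMem fun e he => ?_
      obtain ⟨w, hw⟩ := Set.mem_iUnion.1 he.1
      simpa using he.2 w hw
    rw [hunion, h0, Set.empty_union]
    exact hcell
  have hS' : Piling.DownClosed (S.erase v : Set (Piling (faceGraph K))) := by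
    intro w hw i hi
    rw [Finset.mem_coe, Finset.mem_erase] at hw ⊢
    refine ⟨fun h => ?_, hS w hw.2 i hi⟩
    have h1 := Piling.length_act_neg_top hi
    have h2 := hmax w hw.2
    rw [h] at h1
    omega
  rw [hunion]
  have hD : (Finset.univ.filter fun i => v.top i ≠ 0).Nonempty := by
    obtain ⟨w, hw⟩ := hne'
    rw [Finset.mem_erase] at hw
    have hwv := hmax w hw.2
    rcases v.exists_top_ne_zero_or with h | ⟨i, hi⟩
    · have h0 : v.length = 0 := by
        rw [h]
        simp [Piling.length]
      rcases w.exists_top_ne_zero_or with h' | ⟨i, hi⟩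
      · exact absurd (h'.trans h.symm) hw.1
      · obtain ⟨u, -, hu⟩ := w.exists_eq_push hi
        have := Piling.length_of_eq_push hi hu
        omega
    · exact ⟨i, by simpa using hi⟩
  refine (ih _ (Finset.erase_ssubset hv) hS' hne').union hcell ?_ (isClosed_subcomplex _)
    (isCompact_range hφ).isClosed
  obtain ⟨ρ, hρ, hρD, hρt⟩ := exists_cube_retraction hD
  have hfar : ∀ t, φ t ∈ subcomplex hdown (S.erase v : Set (Piling (faceGraph K))) ↔
      ∃ i ∈ Finset.univ.filter fun i => v.top i ≠ 0, t i = 1 := by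
    intro t
    have h1 : φ t ∈ star hdown v ↔ ¬ ∃ i ∈ Finset.univ.filter fun i => v.top i ≠ 0, t i = 1 := by
      constructor
      · rintro h ⟨i, hi, hti⟩
        have h2 := h.1 i
        rw [hφp, hti] at h2
        rw [Finset.mem_filter] at hi
        revert h2 hi
        cases v.top i <;> simp
      · intro h
        have h2 : (φ t).proj ∈ latticeStar K v.height := by
          intro i
          rw [hφp]
          by_cases hi : v.top i = 0
          · rw [hi]
            simp
          · have h3 : t i ≠ 1 := fun h' => h ⟨i, by simpa using hi, h'⟩
            have h4 : (t i : ℝ) < 1 := unitInterval.lt_one_iff_ne_one.2 h3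
            have h5 := (t i).2.1
            rw [abs_lt]
            generalize (t i : ℝ) = x at h4 h5 ⊢
            revert hi
            cases v.top i <;> simp <;> constructor <;> linarith
        refine ⟨h2, ?_⟩
        rw [hφc _ _ h2, sub_self, Piling.shift_zero]
        rfl
    rw [← not_iff_not, ← h1]
    constructor
    · intro h
      by_contra h'
      refine h ⟨(hφS t).1, fun w hw => ?_⟩
      rw [Finset.mem_coe, Finset.mem_erase]
      exact ⟨fun h2 => h' (h2 ▸ hw), (hφS t).2 w hw⟩
    · intro h h'
      simpa using h'.2 v h
  refine isAbsoluteExtensor_of_cube (fun t => φ (ρ t)) (hφ.comp hρ)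
    (fun t => ⟨(hfar _).2 (hρD t), _, rfl⟩) r hr ?_
  rintro _ ⟨he, t, rfl⟩
  rw [hfar] at he
  rw [hρt, hφr _ ⟨t, rfl⟩]
  obtain ⟨i, hi, hti⟩ := he
  refine ⟨i, hi, ?_⟩
  rw [hrφ t i (by simpa using hi), hti]

end PilingCover

/-- A continuous map on a cube of dimension at least two whose composition with a covering map is
constant on the boundary is itself constant on the boundary. -/
theorem IsCoveringMap.eq_zero_of_mem_cubeBoundary {E X : Type*} [TopologicalSpace E]
    [TopologicalSpace X] {p : E → X} (hp : IsCoveringMap p) {n : ℕ} (hn : 2 ≤ n)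
    {F : (Fin n → unitInterval) → E} (hF : Continuous F) {y : X}
    (hy : ∀ q ∈ Cube.boundary (Fin n), p (F q) = y) {q : Fin n → unitInterval}
    (hq : q ∈ Cube.boundary (Fin n)) : F q = F 0 := by
  have hface : ∀ (i : Fin n) (q q' : Fin n → unitInterval), q i = q' i → (q i = 0 ∨ q i = 1) →
      F q = F q' := by
    intro i q q' hqq hq
    have hs : IsPreconnected (Set.range fun r : Fin n → unitInterval =>
        Function.update r i (q i)) :=
      isPreconnected_range (continuous_id.update i continuous_const)
    refine hp.constOn_of_comp hs hF.continuousOn ?_ ⟨q, by simp⟩ ⟨q', by simp [hqq]⟩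
    rintro _ ⟨r, rfl⟩ _ ⟨r', rfl⟩
    rw [hy _ ⟨i, by simpa using hq⟩, hy _ ⟨i, by simpa using hq⟩]
  obtain ⟨i, hi⟩ := hq
  have : Nontrivial (Fin n) := Fin.nontrivial_iff_two_le.2 hn
  obtain ⟨j, hj⟩ := exists_ne i
  rw [hface i q (Function.update q j 0) (by simp [hj.symm]) hi]
  exact hface j _ _ (by simp) (by simp)

namespace PilingCover

variable {m : ℕ} {K : Finset (Finset (Fin m))} {hdown : ∀ I ∈ K, ∀ J ⊆ I, J ∈ K}

theorem exists_isAbsoluteExtensor (hflag : ∀ J : Finset (Fin m),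
      (∀ i ∈ J, ∀ j ∈ J, i ≠ j → ({i, j} : Finset (Fin m)) ∈ K) → J ∈ K)
    {C : Set (PilingCover hdown)} (hC : IsCompact C) (hne : C.Nonempty)
    (h : C ⊆ mainComponent hdown) :
    ∃ S : Set (PilingCover hdown), C ⊆ S ∧ IsAbsoluteExtensor S := by
  obtain ⟨e, he⟩ := hne
  obtain ⟨k, hk⟩ := exists_subset_subcomplex hC h
  refine ⟨_, hk, ?_⟩
  have hfin := Piling.finite_setOf_length_le (G := faceGraph K) k
  have := isAbsoluteExtensor_subcomplex (hdown := hdown) hflag hfin.toFinset ?_ ?_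
  · rwa [hfin.coe_toFinset] at this
  · rw [hfin.coe_toFinset]
    intro v hv i hi
    have h1 := Piling.length_act_neg_top hi
    rw [Set.mem_ofPred_eq] at hv ⊢
    omega
  · obtain ⟨v, hv⟩ := Set.mem_iUnion.1 (hk he).1
    exact ⟨v, hfin.mem_toFinset.2 ((hk he).2 v hv)⟩

theorem pathConnectedSpace (hempty : (∅ : Finset (Fin m)) ∈ K) (hflag : ∀ J : Finset (Fin m),
      (∀ i ∈ J, ∀ j ∈ J, i ≠ j → ({i, j} : Finset (Fin m)) ∈ K) → J ∈ K)
    (hdown : ∀ I ∈ K, ∀ J ⊆ I, J ∈ K) : PathConnectedSpace (realPolyhedralProduct m K) := by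
  refine ⟨⟨⟨0, ∅, hempty, fun k _ => ⟨0, by simp⟩⟩⟩, fun x y => ?_⟩
  obtain ⟨e₀, h₀, rfl⟩ := exists_mem_mainComponent (hdown := hdown) x
  obtain ⟨e₁, h₁, rfl⟩ := exists_mem_mainComponent (hdown := hdown) y
  obtain ⟨S, hS, hext⟩ := exists_isAbsoluteExtensor hflag
    (Set.toFinite {e₀, e₁}).isCompact ⟨e₀, by simp⟩ (Set.pair_subset h₀ h₁)
  rw [Set.pair_subset_iff] at hS
  classical
  obtain ⟨g, hg, -, hgA⟩ := hext unitInterval {0, 1} (Set.toFinite _).isClosed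
    (fun t => if t = 0 then e₀ else e₁) ((Set.toFinite _).continuousOn _)
    (by
      intro t _
      dsimp only
      split_ifs
      exacts [hS.1, hS.2])
  refine ⟨⟨⟨fun t => (g t).proj, isCoveringMap_proj.continuous.comp hg⟩, ?_, ?_⟩⟩
  · simp [hgA (show (0 : unitInterval) ∈ ({0, 1} : Set _) by simp)]
  · simp [hgA (show (1 : unitInterval) ∈ ({0, 1} : Set _) by simp)]

theorem exists_lift_cube {n : ℕ} (f : C(Fin n → unitInterval, realPolyhedralProduct m K)) :
    ∃ F : C(Fin n → unitInterval, PilingCover hdown), (∀ q, F q ∈ mainComponent hdown) ∧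
      ∀ q, (F q).proj = f q := by
  obtain ⟨e, he, hef⟩ := exists_mem_mainComponent (hdown := hdown) (f 0)
  let H : C(unitInterval × (Fin n → unitInterval), realPolyhedralProduct m K) :=
    ⟨fun z => f fun i => z.1 * z.2 i, by fun_prop⟩
  have H0 : ∀ q, H (0, q) = proj (ContinuousMap.const (Fin n → unitInterval) e q) := by
    intro q
    rw [ContinuousMap.const_apply, hef]
    exact congrArg f (funext fun i => zero_mul _)
  let L := isCoveringMap_proj.liftHomotopy H (ContinuousMap.const _ e) H0
  have hL : ∀ z, (L z).proj = H z := fun z =>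
    congrFun (isCoveringMap_proj.liftHomotopy_lifts H (ContinuousMap.const _ e) H0) z
  have hL0 : L (0, 0) = e := isCoveringMap_proj.liftHomotopy_zero H (ContinuousMap.const _ e) H0 0
  have hmain : ∀ z, L z ∈ mainComponent hdown := by
    have h := (IsClopen.preimage ⟨isClosed_mainComponent, isOpen_mainComponent⟩
      L.continuous).eq_univ ⟨(0, 0), by simpa [hL0] using he⟩
    exact Set.eq_univ_iff_forall.1 h
  refine ⟨L.comp ⟨fun q => (1, q), by fun_prop⟩, fun q => hmain _, fun q => ?_⟩
  refine (hL _).trans (congrArg f (funext fun i => one_mul _))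

theorem homotopic_const (hflag : ∀ J : Finset (Fin m),
      (∀ i ∈ J, ∀ j ∈ J, i ≠ j → ({i, j} : Finset (Fin m)) ∈ K) → J ∈ K)
    (hdown : ∀ I ∈ K, ∀ J ⊆ I, J ∈ K) {n : ℕ} (hn : 2 ≤ n) {y : realPolyhedralProduct m K}
    (f : GenLoop (Fin n) (realPolyhedralProduct m K) y) :
    GenLoop.Homotopic f GenLoop.const := by
  obtain ⟨F, hF, hFf⟩ := exists_lift_cube (hdown := hdown) f.1
  have hbd : ∀ q ∈ Cube.boundary (Fin n), F q = F 0 := fun q hq =>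
    isCoveringMap_proj.eq_zero_of_mem_cubeBoundary hn F.continuous
      (fun q hq => (hFf q).trans (f.2 q hq)) hq
  have hy : (F 0).proj = y := by
    refine (hFf 0).trans (f.2 0 ⟨⟨0, by omega⟩, Or.inl rfl⟩)
  obtain ⟨S, hS, hext⟩ := exists_isAbsoluteExtensor hflag (isCompact_range F.continuous)
    (Set.range_nonempty F) (Set.range_subset_iff.2 hF)
  have hcb : IsClosed (Cube.boundary (Fin n)) := by
    have : Cube.boundary (Fin n) = ⋃ i, {q | q i = 0} ∪ {q | q i = 1} := by
      ext q
      simp [Cube.boundary]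
    rw [this]
    exact isClosed_iUnion_of_finite fun i =>
      (isClosed_eq (continuous_apply i) continuous_const).union
        (isClosed_eq (continuous_apply i) continuous_const)
  let A₀ : Set (unitInterval × (Fin n → unitInterval)) := {z | z.1 = 0}
  let A₁ : Set (unitInterval × (Fin n → unitInterval)) := {z | z.1 = 1 ∨ z.2 ∈ Cube.boundary (Fin n)}
  have hA₀ : IsClosed A₀ := isClosed_eq continuous_fst continuous_const
  have hA₁ : IsClosed A₁ :=
    (isClosed_eq continuous_fst continuous_const).union (hcb.preimage continuous_snd)
  classical
  let φ : unitInterval × (Fin n → unitInterval) → PilingCover hdown := fun z =>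
    if z.1 = 0 then F z.2 else F 0
  have hφ₁ : ∀ z ∈ A₁, φ z = F 0 := by
    rintro ⟨t, q⟩ hz
    by_cases ht : t = 0
    · simp only [φ, ht, if_true]
      refine hbd q (hz.resolve_left fun h => ?_)
      exact zero_ne_one (ht.symm.trans h)
    · simp [φ, ht]
  have hφc : ContinuousOn φ (A₀ ∪ A₁) := by
    refine ContinuousOn.union_of_isClosed ?_ ?_ hA₀ hA₁
    · exact (F.continuous.comp continuous_snd).continuousOn.congr fun z hz => if_pos hz
    · exact continuousOn_const.congr hφ₁
  obtain ⟨g, hg, -, hgA⟩ := hext _ _ (hA₀.union hA₁) φ hφc (by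
    intro z _
    dsimp only [φ]
    split_ifs <;> exact hS ⟨_, rfl⟩)
  have hg₁ : ∀ z ∈ A₁, (g z).proj = y := fun z hz => by rw [hgA (Or.inr hz), hφ₁ z hz, hy]
  refine ⟨⟨⟨⟨fun z => (g z).proj, isCoveringMap_proj.continuous.comp hg⟩, fun q => ?_,
    fun q => ?_⟩, fun t q hq => ?_⟩⟩
  · change (g (0, q)).proj = f.1 q
    rw [hgA (Or.inl rfl), ← hFf]
    simp [φ]
  · exact hg₁ _ (Or.inl rfl)
  · exact (hg₁ _ (Or.inr hq)).trans (f.2 q hq).symm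

end PilingCover

/-- The polyhedral product `L_K` is aspherical (path-connected with trivial homotopy groups
`π_n` for all `n ≥ 2` and all basepoints) if and only if `K` is a flag complex. -/
theorem real_polyhedral_product_aspherical_iff_flag (m : ℕ) (K : Finset (Finset (Fin m)))
    (hdown : ∀ I ∈ K, ∀ J ⊆ I, J ∈ K) (hempty : (∅ : Finset (Fin m)) ∈ K)
    (hsingle : ∀ i : Fin m, ({i} : Finset (Fin m)) ∈ K) :
    (PathConnectedSpace (realPolyhedralProduct m K) ∧
        ∀ (y : realPolyhedralProduct m K) (n : ℕ), 2 ≤ n →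
          Subsingleton (HomotopyGroup (Fin n) (realPolyhedralProduct m K) y)) ↔
      (∀ J : Finset (Fin m),
        (∀ i ∈ J, ∀ j ∈ J, i ≠ j → ({i, j} : Finset (Fin m)) ∈ K) → J ∈ K) := by
  refine ⟨fun h J hJ => flag_of_subsingleton_homotopyGroup m K hdown hempty hsingle h.2 J hJ,
    fun hflag => ⟨PilingCover.pathConnectedSpace hempty hflag hdown, fun y n hn => ?_⟩⟩
  have h : ∀ a : HomotopyGroup (Fin n) (realPolyhedralProduct m K) y,
      a = Quotient.mk (GenLoop.Homotopic.setoid (Fin n) y) GenLoop.const := by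
    refine Quotient.ind fun f => Quotient.sound ?_
    exact PilingCover.homotopic_const hflag hdown hn f
  exact ⟨fun a b => (h a).trans (h b).symm⟩
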